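/- arXiv:2310.19611 — 3 statements merged into one kernel-verified Lean document; each statement's English description precedes it below -/
import Mathlib

section
/- Let k ≥ 3 and N ≥ 3, and let φ : SO(k) → SO(N) be a continuous group homomorphism such that no one-dimensional linear subspace of ℝ^N is invariant under φ(g) for all g ∈ SO(k). Then the subgroup of SO(N) generated by the set of matrices E_σ⁻¹ φ(g) E_σ, as g ranges over SO(k) and σ ranges over the symmetric group S_N, is all of SO(N). -/
open Matrix

/-- The special orthogonal group `SO(n)`, realized as the subgroup of the orthogonal group
`O(n)` consisting of the matrices of determinant one. -/
def SO (n : ℕ) : Subgroup (Matrix.orthogonalGroup (Fin n) ℝ) where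
  carrier := {A | Matrix.det (A : Matrix (Fin n) (Fin n) ℝ) = 1}
  mul_mem' := by
    intro a b ha hb
    simp only [Set.mem_setOf_eq, Submonoid.coe_mul, Matrix.det_mul] at *
    rw [ha, hb, mul_one]
  one_mem' := by
    simp [Set.mem_setOf_eq]
  inv_mem' := by
    intro a ha
    simp only [Set.mem_setOf_eq] at *
    have h : ((a⁻¹ * a : Matrix.orthogonalGroup (Fin n) ℝ) : Matrix (Fin n) (Fin n) ℝ)
        = (1 : Matrix (Fin n) (Fin n) ℝ) := by
      rw [inv_mul_cancel]; rfl
    have := congrArg Matrix.det h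
    rw [Submonoid.coe_mul, Matrix.det_mul, ha, mul_one, Matrix.det_one] at this
    exact this

open Matrix Filter Topology

section aux

variable {A : Type*} [NormedRing A] [NormedAlgebra ℝ A] [FiniteDimensional ℝ A]

/-- A continuous one-parameter group is strictly differentiable. -/
theorem aux_onePar (f : ℝ → A) (hf : Continuous f)
    (h0 : f 0 = 1) (hadd : ∀ s t, f (s + t) = f s * f t) :
    ∃ X : A, ∀ t, HasStrictDerivAt f (f t * X) t := by
  have : CompleteSpace A := FiniteDimensional.complete ℝ A
  set F : ℝ → A := fun a => ∫ s in (0:ℝ)..a, f s with hF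
  have hFd : ∀ t, HasStrictDerivAt F (f t) t := fun t => hf.integral_hasStrictDerivAt 0 t
  have hex : ∃ a : ℝ, IsUnit (F a) := by
    have h1 : HasDerivAt F 1 0 := by simpa [h0] using (hFd 0).hasDerivAt
    rw [hasDerivAt_iff_tendsto_slope] at h1
    have h2 : ∀ᶠ a in 𝓝[≠] (0:ℝ), IsUnit (slope F 0 a) :=
      h1 (Units.isOpen.mem_nhds (by simp))
    have h3 : ∀ᶠ a in 𝓝[≠] (0:ℝ), a ≠ 0 := eventually_mem_nhdsWithin
    obtain ⟨a, ha, ha0⟩ := (h2.and h3).exists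
    refine ⟨a, ?_⟩
    have h4 : slope F 0 a = a⁻¹ • F a := by simp [slope, hF]
    rw [h4] at ha
    have h5 : F a = (Units.mk0 a ha0) • (a⁻¹ • F a) := by
      simp [Units.smul_def, smul_smul, ha0]
    rw [h5]
    exact ha.smul _
  obtain ⟨a, u, hu⟩ := hex
  have key : ∀ t, f t * F a = F (t + a) - F t := by
    intro t
    have e1 : f t * F a = ∫ s in (0:ℝ)..a, f (t + s) := by
      simp only [hadd]
      exact ((ContinuousLinearMap.mul ℝ _ (f t)).intervalIntegral_comp_comm
        (hf.intervalIntegrable 0 a)).symm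
    rw [e1, intervalIntegral.integral_comp_add_left (fun s => f s) t, add_zero]
    exact (intervalIntegral.integral_interval_sub_left (hf.intervalIntegrable _ _)
      (hf.intervalIntegrable _ _)).symm
  have key2 : f = fun t => (F (t + a) - F t) * (↑u⁻¹ : A) := by
    funext t
    rw [← key, ← hu, mul_assoc, Units.mul_inv, mul_one]
  refine ⟨(f a - 1) * (↑u⁻¹ : A), fun t => ?_⟩
  have h6 : HasStrictDerivAt (fun t => (F (t + a) - F t) * (↑u⁻¹ : A))
      ((f (t + a) - f t) * (↑u⁻¹ : A)) t := by
    have h7 : HasStrictDerivAt (fun t => F (t + a)) (f (t + a)) t := by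
      have := (hFd (t + a)).scomp t ((hasStrictDerivAt_id t).add_const a)
      simpa [Function.comp_def] using this
    exact (h7.sub (hFd t)).mul_const _
  rw [← key2] at h6
  convert h6 using 1
  rw [hadd, ← mul_assoc, mul_sub, mul_one]

/-- Tangent vectors at the identity of a submonoid. -/
def auxTan (G : Submonoid A) : Submodule ℝ A where
  carrier := {Y | ∃ F : ℝ → A, (∀ t, F t ∈ G) ∧ F 0 = 1 ∧ HasStrictDerivAt F Y 0}
  add_mem' := by
    rintro Y Z ⟨F, hF, hF0, hFd⟩ ⟨E, hE, hE0, hEd⟩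
    refine ⟨F * E, fun t => G.mul_mem (hF t) (hE t), by simp [hF0, hE0], ?_⟩
    have := hFd.mul hEd
    simpa [hF0, hE0] using this
  zero_mem' := ⟨fun _ => 1, fun _ => G.one_mem, rfl, hasStrictDerivAt_const _ _⟩
  smul_mem' := by
    rintro c Y ⟨F, hF, hF0, hFd⟩
    refine ⟨fun t => F (c * t), fun t => hF _, by simp [hF0], ?_⟩
    have h1 : HasStrictDerivAt F Y (c * 0) := by simpa using hFd
    have := h1.scomp (0:ℝ) ((hasStrictDerivAt_id (0:ℝ)).const_mul c)
    simpa [Function.comp_def] using this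

theorem auxTan_mem {G : Submonoid A} {Y : A} : Y ∈ auxTan G ↔
    ∃ F : ℝ → A, (∀ t, F t ∈ G) ∧ F 0 = 1 ∧ HasStrictDerivAt F Y 0 := Iff.rfl

theorem auxTan_conj {G : Submonoid A}
    {Y P B : A} (hAB : P * B = 1) (h : ∀ g ∈ G, P * g * B ∈ G)
    (hY : Y ∈ auxTan G) : P * Y * B ∈ auxTan G := by
  obtain ⟨F, hF, hF0, hFd⟩ := hY
  exact ⟨fun t => P * F t * B, fun t => h _ (hF t), by simp [hF0, hAB],
    (hFd.const_mul P).mul_const B⟩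

theorem aux_derivT (τ : A →ₗ[ℝ] A) {F : ℝ → A} {X : A} {t : ℝ} (h : HasDerivAt F X t) :
    HasDerivAt (fun t => τ (F t)) (τ X) t :=
  (LinearMap.toContinuousLinearMap τ).hasFDerivAt.comp_hasDerivAt t h

theorem auxTan_skew {G : Submonoid A} (τ : A →ₗ[ℝ] A) (hτ1 : τ 1 = 1)
    (hG1 : ∀ g ∈ G, g * τ g = 1) {X : A}
    (hX : X ∈ auxTan G) : τ X = -X := by
  obtain ⟨F, hF, hF0, hFd⟩ := hX
  have h1 := hFd.hasDerivAt.mul (aux_derivT τ hFd.hasDerivAt)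
  have h2 : F * (fun t => τ (F t)) = fun _ => 1 := by
    funext t; exact hG1 _ (hF t)
  rw [h2] at h1
  have h3 := h1.unique (hasDerivAt_const (0:ℝ) (1:A))
  simp only [hF0, hτ1, mul_one, one_mul] at h3
  exact (neg_eq_of_add_eq_zero_right h3).symm

theorem auxTan_bracket {G : Submonoid A} (τ : A →ₗ[ℝ] A) (hτ1 : τ 1 = 1)
    (hG : ∀ g ∈ G, τ g ∈ G) (hG1 : ∀ g ∈ G, g * τ g = 1)
    {X Y : A} 
    (hX : X ∈ auxTan G) (hY : Y ∈ auxTan G) : X * Y - Y * X ∈ auxTan G := by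
  have hXs := auxTan_skew τ hτ1 hG1 hX
  obtain ⟨F, hF, hF0, hFd⟩ := hX
  have hT := aux_derivT τ hFd.hasDerivAt
  have hd : HasDerivAt ((fun t => F t * Y) * (fun t => τ (F t))) (X * Y - Y * X) 0 := by
    have := (hFd.hasDerivAt.mul_const Y).mul hT
    simpa [hF0, hXs, hτ1, sub_eq_add_neg] using this
  have hcl : IsClosed ((auxTan G : Submodule ℝ A) : Set A) :=
    Submodule.closed_of_finiteDimensional _
  rw [hasDerivAt_iff_tendsto_slope] at hd
  refine hcl.mem_of_tendsto hd (Eventually.of_forall fun t => ?_)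
  have hm : ∀ t, F t * Y * τ (F t) ∈ auxTan G := fun t =>
    auxTan_conj (hG1 _ (hF t)) (fun g hg => G.mul_mem (G.mul_mem (hF t) hg) (hG _ (hF t))) hY
  simp only [slope, vsub_eq_sub]
  exact Submodule.smul_mem _ _ (Submodule.sub_mem _ (hm _) (hm _))

theorem aux_listProd {E ι : Type*} [NormedAddCommGroup E] [NormedSpace ℝ E]
    (f : ι → E → A) (f' : ι → E →L[ℝ] A) (x : E) (h0 : ∀ i, f i x = 1)
    (h : ∀ i, HasStrictFDerivAt (f i) (f' i) x) (l : List ι) :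
    HasStrictFDerivAt (fun y => (l.map (fun i => f i y)).prod) ((l.map f').sum) x := by
  induction l with
  | nil => simpa using hasStrictFDerivAt_const (1:A) x
  | cons i l ih =>
    have h1 := (h i).mul' ih
    have h2 : (l.map (fun i => f i x)).prod = 1 := by
      apply List.prod_eq_one
      intro y hy
      obtain ⟨i, -, rfl⟩ := List.mem_map.1 hy
      exact h0 i
    simp only [List.map_cons, List.prod_cons, List.sum_cons]
    refine HasStrictFDerivAt.congr_fderiv h1 ?_
    rw [h0, h2, MulOpposite.op_one, one_smul, one_smul, add_comm]

theorem auxTan_open {G : Submonoid A} (τ : A →ₗ[ℝ] A) (hτ1 : τ 1 = 1)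
    (hτm : ∀ a b, τ (a * b) = τ b * τ a) (hττ : ∀ a, τ (τ a) = a)
    (hG2 : ∀ g ∈ G, τ g * g = 1)
    (hall : ∀ Y : A, τ Y = -Y → Y ∈ auxTan G) :
    ∀ᶠ a in 𝓝 (1 : A), τ a * a = 1 → a ∈ G := by
  have : CompleteSpace A := FiniteDimensional.complete ℝ A
  let b := Module.finBasis ℝ (auxTan G)
  choose f hf hf0 hfd using fun j => auxTan_mem.1 (b j).2
  let d := Module.finrank ℝ (auxTan G)
  let S : Submodule ℝ A := LinearMap.eqLocus τ LinearMap.id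
  let E := (Fin d → ℝ) × S
  let pr : Fin d → E →L[ℝ] ℝ := fun j =>
    (ContinuousLinearMap.proj (R := ℝ) (φ := fun _ : Fin d => ℝ) j).comp
        (ContinuousLinearMap.fst ℝ (Fin d → ℝ) S)
  let P : E → A := fun x => ((List.finRange d).map fun j => f j (pr j x)).prod
  have hP : HasStrictFDerivAt P
      (((List.finRange d).map fun j => (pr j).smulRight (b j : A)).sum) 0 := by
    apply aux_listProd (fun j x => f j (pr j x))
    · intro i; simp [hf0]
    · intro i
      have h1 : HasStrictDerivAt (f i) (b i : A) (pr i 0) := by simpa using hfd i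
      have h2 := h1.hasStrictFDerivAt.comp (0:E) (pr i).hasStrictFDerivAt
      exact h2.congr_fderiv (ContinuousLinearMap.ext fun x => rfl)
  have hPG : ∀ x, P x ∈ G := by
    intro x
    apply Submonoid.list_prod_mem
    intro y hy
    obtain ⟨i, -, rfl⟩ := List.mem_map.1 hy
    exact hf _ _
  have hP0 : P 0 = 1 := by
    apply List.prod_eq_one
    intro y hy
    obtain ⟨i, -, rfl⟩ := List.mem_map.1 hy
    simp [hf0]
  let sn : E →L[ℝ] A := S.subtypeL.comp (ContinuousLinearMap.snd ℝ (Fin d → ℝ) S)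
  have hQ := hP.mul' (sn.hasStrictFDerivAt (x := 0) |>.const_add 1)
  have hmap := hQ.map_nhds_eq_of_surj (by
    rw [LinearMap.range_eq_top]
    intro Z
    have hZ1 : (1/2 : ℝ) • (Z - τ Z) ∈ auxTan G := hall _ (by
      simp only [map_smul, map_sub, hττ, ← smul_neg, neg_sub])
    have hZ2 : (1/2 : ℝ) • (Z + τ Z) ∈ S := by
      change τ _ = _
      simp only [map_smul, map_add, hττ, LinearMap.id_apply, add_comm]
    refine ⟨(b.repr ⟨_, hZ1⟩, ⟨_, hZ2⟩), ?_⟩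
    have h3 : ∑ j, b.repr ⟨_, hZ1⟩ j • (b j : A) = (1/2 : ℝ) • (Z - τ Z) := by
      have := congrArg (Subtype.val) (b.sum_repr ⟨_, hZ1⟩)
      refine Eq.trans ?_ this
      simp only [Submodule.coe_sum, Submodule.coe_smul]
    have h4 : ∀ x : E, ((List.finRange d).map fun j => (pr j).smulRight (b j : A)).sum x
        = ∑ j, x.1 j • (b j : A) := by
      intro x
      rw [← List.sum_ofFn, ← List.ofFn_eq_map]
      simp only [List.sum_ofFn, _root_.sum_apply]
      rfl
    have h5 : (1/2 : ℝ) • (Z + τ Z) + (1/2 : ℝ) • (Z - τ Z) = Z := by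
      rw [← smul_add, add_add_sub_cancel, ← two_smul ℝ Z, smul_smul]; norm_num
    rw [hP0, map_zero, add_zero, MulOpposite.op_one, one_smul, one_smul]
    refine Eq.trans ?_ h5
    exact congrArg (fun z => (1/2 : ℝ) • (Z + τ Z) + z) ((h4 _).trans h3))
  have hsmall : ∀ᶠ x : E in 𝓝 0, IsUnit (2 + sn x) := by
    have hc : Continuous fun x : E => 2 + sn x := continuous_const.add sn.continuous
    refine hc.continuousAt.eventually (Units.isOpen.mem_nhds ?_)
    have : IsUnit ((algebraMap ℝ A) 2) := (IsUnit.mk0 (2:ℝ) two_ne_zero).map _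
    have h2 : (algebraMap ℝ A) 2 = 2 := map_ofNat _ 2
    rw [h2] at this
    simpa using this
  have hev := Filter.image_mem_map (m := P * fun y => 1 + sn y) hsmall
  rw [hmap] at hev
  simp only [Pi.mul_apply, hP0, map_zero, add_zero, mul_one] at hev
  filter_upwards [hev] with a ha haa
  obtain ⟨x, hx, rfl⟩ := ha
  simp only at haa ⊢
  have hs : τ (sn x) = sn x := x.2.2
  have h1 : τ (P x) * P x = 1 := by
    exact hG2 _ (hPG x)
  have h2 : (1 + sn x) * (1 + sn x) = 1 := by
    simp only [hτm, map_add, hτ1, hs] at haa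
    rw [mul_assoc, ← mul_assoc (τ (P x)), h1, one_mul] at haa
    exact haa
  have h3 : (2 + sn x) * sn x = 0 := by
    have : (2 + sn x) * sn x = (1 + sn x) * (1 + sn x) - 1 := by noncomm_ring
    rw [this, h2, sub_self]
  have hx' : IsUnit (2 + sn x) := hx
  have h4 : sn x = 0 := by
    simpa using hx'.mul_left_cancel (h3.trans (mul_zero _).symm)
  simp only [h4, add_zero, mul_one]
  exact hPG x

/-- All that is needed about tangent spaces, without reference to a norm. -/
theorem aux_package (G : Submonoid A) (τ : A →ₗ[ℝ] A) (hτ1 : τ 1 = 1)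
    (hτm : ∀ a b, τ (a * b) = τ b * τ a) (hττ : ∀ a, τ (τ a) = a)
    (hG : ∀ g ∈ G, τ g ∈ G)
    (hG1 : ∀ g ∈ G, g * τ g = 1) (hG2 : ∀ g ∈ G, τ g * g = 1) :
    ∃ T : Submodule ℝ A,
      (∀ X ∈ T, τ X = -X) ∧
      (∀ X ∈ T, ∀ Y ∈ T, X * Y - Y * X ∈ T) ∧
      (∀ P B : A, P * B = 1 → (∀ g ∈ G, P * g * B ∈ G) → ∀ Y ∈ T, P * Y * B ∈ T) ∧
      (∀ f : ℝ → A, Continuous f → f 0 = 1 → (∀ s t, f (s + t) = f s * f t) →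
        (∀ t, f t ∈ G) → ∃ X ∈ T, ∀ v : A, X * v = 0 → ∀ t, f t * v = v) ∧
      ((∀ Y : A, τ Y = -Y → Y ∈ T) → ∀ᶠ a in 𝓝 (1 : A), τ a * a = 1 → a ∈ G) := by
  refine ⟨auxTan G, fun X hX => auxTan_skew τ hτ1 hG1 hX,
    fun X hX Y hY => auxTan_bracket τ hτ1 hG hG1 hX hY,
    fun P B h1 h2 Y hY => auxTan_conj h1 h2 hY, ?_,
    fun h => auxTan_open τ hτ1 hτm hττ hG2 h⟩
  intro f hf h0 hadd hfG
  obtain ⟨X, hX⟩ := aux_onePar f hf h0 hadd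
  refine ⟨X, ⟨f, hfG, h0, by simpa [h0] using hX 0⟩, fun v hv t => ?_⟩
  have hd : ∀ s, HasDerivAt (fun s => f s * v) 0 s := by
    intro s
    have := (hX s).hasDerivAt.mul_const v
    rwa [mul_assoc, hv, mul_zero] at this
  have := is_const_of_deriv_eq_zero (fun s => (hd s).differentiableAt) (fun s => (hd s).deriv) t 0
  simpa [h0] using this

end aux

attribute [local instance] Matrix.linftyOpNormedRing Matrix.linftyOpNormedAlgebra in
theorem aux_packageM {N : ℕ} (G : Submonoid (Matrix (Fin N) (Fin N) ℝ)) 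
    (hG : ∀ g ∈ G, gᵀ ∈ G)
    (hG1 : ∀ g ∈ G, g * gᵀ = 1) (hG2 : ∀ g ∈ G, gᵀ * g = 1) :
    ∃ T : Submodule ℝ (Matrix (Fin N) (Fin N) ℝ),
      (∀ X ∈ T, Xᵀ = -X) ∧
      (∀ X ∈ T, ∀ Y ∈ T, X * Y - Y * X ∈ T) ∧
      (∀ P B : Matrix (Fin N) (Fin N) ℝ, P * B = 1 → (∀ g ∈ G, P * g * B ∈ G) →
        ∀ Y ∈ T, P * Y * B ∈ T) ∧
      (∀ f : ℝ → Matrix (Fin N) (Fin N) ℝ, Continuous f → f 0 = 1 →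
        (∀ s t, f (s + t) = f s * f t) →
        (∀ t, f t ∈ G) → ∃ X ∈ T, ∀ v : Matrix (Fin N) (Fin N) ℝ,
          X * v = 0 → ∀ t, f t * v = v) ∧
      ((∀ Y : Matrix (Fin N) (Fin N) ℝ, Yᵀ = -Y → Y ∈ T) →
        ∀ᶠ a in 𝓝 (1 : Matrix (Fin N) (Fin N) ℝ), aᵀ * a = 1 → a ∈ G) := 
  aux_package G (Matrix.transposeLinearEquiv (Fin N) (Fin N) ℝ ℝ).toLinearMap
    Matrix.transpose_one Matrix.transpose_mul Matrix.transpose_transpose hG hG1 hG2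

section alg

open Matrix

theorem aux_lin {N : ℕ} (T : Submodule ℝ (Matrix (Fin N) (Fin N) ℝ))
    (hskew : ∀ X ∈ T, Xᵀ = -X)
    (hbr : ∀ X ∈ T, ∀ Y ∈ T, X * Y - Y * X ∈ T)
    (hperm : ∀ X ∈ T, ∀ σ : Equiv.Perm (Fin N), X.submatrix σ σ ∈ T)
    (X : Matrix (Fin N) (Fin N) ℝ) (hX : X ∈ T) (i : Fin N) (hXi : ∑ j, X i j ≠ 0)
    (Y : Matrix (Fin N) (Fin N) ℝ) (hY : Yᵀ = -Y) : Y ∈ T := by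
  classical
  let K : Fin N → Fin N → Matrix (Fin N) (Fin N) ℝ := fun a b =>
    Matrix.single a b 1 - Matrix.single b a 1
  let S : Fin N → Matrix (Fin N) (Fin N) ℝ := fun a =>
    Matrix.of fun p q => (if p = a then 1 else 0) - (if q = a then (1:ℝ) else 0)
  have hsk : ∀ X ∈ T, ∀ p q, X p q = - X q p := fun X hX p q => by
    have := congrFun (congrFun (hskew X hX) q) p
    simpa using this
  -- averaging
  have hSi : S i ∈ T := by
    let st : Finset (Equiv.Perm (Fin N)) := Finset.univ.filter fun σ => σ i = i
    let B : Matrix (Fin N) (Fin N) ℝ := ∑ σ ∈ st, X.submatrix σ σ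
    have hB : B ∈ T := Submodule.sum_mem _ fun σ _ => hperm X hX σ
    have hBe : ∀ p q, B p q = ∑ σ ∈ st, X (σ p) (σ q) := fun p q => by
      simp [B, Matrix.sum_apply]
    have hBinv : ∀ τ : Equiv.Perm (Fin N), τ i = i → ∀ p q, B (τ p) (τ q) = B p q := by
      intro τ hτ p q
      rw [hBe, hBe]
      refine Finset.sum_bij (fun σ _ => σ * τ) ?_ ?_ ?_ ?_
      · intro σ hσ
        simp only [st, Finset.mem_filter, Finset.mem_univ, true_and] at hσ ⊢
        simp [hτ, hσ]
      · intro a _ b _ h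
        exact mul_right_cancel h
      · intro σ hσ
        simp only [st, Finset.mem_filter, Finset.mem_univ, true_and] at hσ
        refine ⟨σ * τ⁻¹, ?_, by simp⟩
        simp only [st, Finset.mem_filter, Finset.mem_univ, true_and]
        have : τ⁻¹ i = i := by rw [Equiv.Perm.inv_eq_iff_eq, hτ]
        rw [Equiv.Perm.mul_apply, this, hσ]
      · intro σ hσ; simp
    have hB0 : ∀ p q, p ≠ i → q ≠ i → B p q = 0 := by
      intro p q hp hq
      have h1 := hBinv (Equiv.swap p q) (Equiv.swap_apply_of_ne_of_ne hp.symm hq.symm) p q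
      rw [Equiv.swap_apply_left, Equiv.swap_apply_right, hsk B hB] at h1
      linarith
    have hB1 : ∀ p q, p ≠ i → q ≠ i → B i p = B i q := by
      intro p q hp hq
      have h0 := Equiv.swap_apply_of_ne_of_ne hp.symm hq.symm
      have h1 := hBinv (Equiv.swap p q) h0 i p
      rw [h0, Equiv.swap_apply_left] at h1
      exact h1.symm
    have hBii : B i i = 0 := by have := hsk B hB i i; linarith
    have hsum : ∑ j, B i j = (st.card : ℝ) * ∑ j, X i j := by
      simp only [hBe]
      rw [Finset.sum_comm, ← nsmul_eq_mul]
      apply Finset.sum_eq_card_nsmul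
      intro σ hσ
      simp only [st, Finset.mem_filter, Finset.mem_univ, true_and] at hσ
      rw [hσ]
      exact Equiv.sum_comp σ (fun j => X i j)
    have hne : ∑ j, B i j ≠ 0 := by
      rw [hsum]
      refine mul_ne_zero ?_ hXi
      have : (1 : Equiv.Perm (Fin N)) ∈ st := by simp [st]
      exact_mod_cast (Finset.card_pos.2 ⟨_, this⟩).ne'
    obtain ⟨j, -, hj⟩ := Finset.exists_ne_zero_of_sum_ne_zero hne
    have hji : j ≠ i := by rintro rfl; exact hj hBii
    have hBS : S i = (B i j)⁻¹ • B := by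
      ext p q
      simp only [S, Matrix.of_apply, Matrix.smul_apply, smul_eq_mul]
      by_cases hp : p = i <;> by_cases hq : q = i
      · subst hp; subst hq; simp [hBii]
      · subst hp; rw [hB1 q j hq hji]; simp [hq, hj]
      · subst hq; rw [hsk B hB p q, hB1 p j hp hji]; simp [hp, hj]
      · simp [hp, hq, hB0 p q hp hq]
    rw [hBS]
    exact Submodule.smul_mem _ _ hB
  have hS : ∀ a, S a ∈ T := by
    intro a
    have h1 := hperm _ hSi (Equiv.swap i a)
    convert h1 using 1
    ext p q
    have : ∀ p, (Equiv.swap i a p = i) = (p = a) := fun p => by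
      rw [Equiv.swap_apply_eq_iff, Equiv.swap_apply_left]
    simp only [S, Matrix.of_apply, Matrix.submatrix_apply, this]
  have hNpos : (N : ℝ) ≠ 0 := by
    have := i.pos; positivity
  have hK : ∀ a b, K a b ∈ T := by
    intro a b
    by_cases hab : a = b
    · subst hab; simp [K]
    have h1 : K a b = (N : ℝ)⁻¹ • (S a - S b - (S a * S b - S b * S a)) := by
      rw [eq_inv_smul_iff₀ hNpos]
      ext p q
      simp only [K, S, Matrix.smul_apply, Matrix.sub_apply, Matrix.mul_apply, Matrix.of_apply,
        Matrix.single_apply, smul_eq_mul]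
      simp only [sub_mul, mul_sub, Finset.sum_sub_distrib]
      simp [hab, Ne.symm hab, ite_and]
      simp only [eq_comm (a := a) (b := p), eq_comm (a := b) (b := q), eq_comm (a := b) (b := p),
        eq_comm (a := a) (b := q)]
      split_ifs <;> ring
    rw [h1]
    exact Submodule.smul_mem _ _ (Submodule.sub_mem _ (Submodule.sub_mem _ (hS a) (hS b))
      (hbr _ (hS a) _ (hS b)))
  have hYd : Y = ∑ a, ∑ b, (Y a b / 2) • K a b := by
    have hYe : ∀ p q, Y q p = - Y p q := fun p q => by
      have := congrFun (congrFun hY p) q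
      simpa using this
    ext p q
    simp only [Matrix.sum_apply, K, Matrix.smul_apply, Matrix.sub_apply, Matrix.single_apply,
      smul_eq_mul, mul_sub, Finset.sum_sub_distrib]
    simp [ite_and]
    rw [hYe p q]; ring
  rw [hYd]
  exact Submodule.sum_mem _ fun a _ => Submodule.sum_mem _ fun b _ =>
    Submodule.smul_mem _ _ (hK a b)

end alg
section gen

open Matrix

/-- The Householder reflection. -/
def auxH {n : ℕ} (u : Fin n → ℝ) : Matrix (Fin n) (Fin n) ℝ := 1 - (2:ℝ) • vecMulVec u u

theorem auxH_mulVec {n : ℕ} (u x : Fin n → ℝ) : auxH u *ᵥ x = x - (2 * (u ⬝ᵥ x)) • u := by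
  ext i
  simp [auxH, sub_mulVec, smul_mulVec, vecMulVec_mulVec]
  ring

theorem auxH_transpose {n : ℕ} (u : Fin n → ℝ) : (auxH u)ᵀ = auxH u := by
  simp [auxH, transpose_vecMulVec]

theorem auxH_mul_self {n : ℕ} (u : Fin n → ℝ) (hu : u ⬝ᵥ u = 1) : auxH u * auxH u = 1 := by
  have h : vecMulVec u u * vecMulVec u u = vecMulVec u u := by
    rw [vecMulVec_mul_vecMulVec, hu]; simp
  simp only [auxH, sub_mul, mul_sub, one_mul, mul_one, Matrix.smul_mul, Matrix.mul_smul, h]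
  module

theorem auxH_det {n : ℕ} (u : Fin n → ℝ) (hu : u ⬝ᵥ u = 1) : (auxH u).det = -1 := by
  have h : auxH u = 1 + vecMulVec ((-2:ℝ) • u) u := by
    rw [auxH, smul_vecMulVec]; module
  rw [h, vecMulVec_eq Unit, det_one_add_replicateCol_mul_replicateRow]
  simp [hu]
  norm_num

theorem aux_refl {n : ℕ} (s : Finset (Fin n)) : ∀ A : Matrix (Fin n) (Fin n) ℝ, Aᵀ * A = 1 →
    (∀ j, j ∉ s → A *ᵥ Pi.single j 1 = Pi.single j 1) →
    A ∈ Submonoid.closure {B | ∃ u : Fin n → ℝ, u ⬝ᵥ u = 1 ∧ B = auxH u} := by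
  induction s using Finset.induction_on with
  | empty =>
    intro A _ h
    have : A = 1 := by
      apply Matrix.ext_of_mulVec_single
      intro i
      rw [h i (by simp), one_mulVec]
    rw [this]; exact Submonoid.one_mem _
  | insert i s hi ih =>
    intro A hA h
    have hdot : ∀ x y, (A *ᵥ x) ⬝ᵥ (A *ᵥ y) = x ⬝ᵥ y := by
      intro x y
      rw [dotProduct_mulVec, vecMul_mulVec, ← dotProduct_mulVec, hA]
      simp
    let e : Fin n → (Fin n → ℝ) := fun j => Pi.single j 1
    let w := A *ᵥ e i - e i
    by_cases hw : w = 0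
    · apply ih A hA
      intro j hj
      by_cases hji : j = i
      · subst hji; exact sub_eq_zero.1 hw
      · exact h j (by simp [hj, hji])
    have hww : 0 < w ⬝ᵥ w := by
      have h1 : 0 ≤ w ⬝ᵥ w := Finset.sum_nonneg fun i _ => mul_self_nonneg _
      have h2 : w ⬝ᵥ w ≠ 0 := fun h => hw (dotProduct_self_eq_zero.1 h)
      exact lt_of_le_of_ne h1 h2.symm
    let c := √(w ⬝ᵥ w)
    have hc : c ^ 2 = w ⬝ᵥ w := Real.sq_sqrt hww.le
    have hc0 : c ≠ 0 := (Real.sqrt_pos.2 hww).ne'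
    let u := c⁻¹ • w
    have hu : u ⬝ᵥ u = 1 := by
      simp only [u, smul_dotProduct, dotProduct_smul, smul_eq_mul, ← hc]
      field_simp
    have hee : e i ⬝ᵥ e i = 1 := by simp [e]
    have hwe : 2 * (w ⬝ᵥ (A *ᵥ e i)) = w ⬝ᵥ w := by
      simp only [w, sub_dotProduct, dotProduct_sub, hdot, hee, dotProduct_comm (A *ᵥ e i) (e i)]
      ring
    have hA' : auxH u * A ∈ Submonoid.closure {B | ∃ u : Fin n → ℝ, u ⬝ᵥ u = 1 ∧ B = auxH u} := by
      apply ih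
      · rw [transpose_mul, auxH_transpose, mul_assoc, ← mul_assoc (auxH u), auxH_mul_self u hu,
          one_mul, hA]
      · intro j hj
        rw [← mulVec_mulVec, auxH_mulVec]
        by_cases hji : j = i
        · subst hji
          have : (2 * (u ⬝ᵥ (A *ᵥ e j))) • u = w := by
            simp only [u, smul_dotProduct, smul_smul, smul_eq_mul]
            have : 2 * (c⁻¹ * (w ⬝ᵥ A *ᵥ e j)) * c⁻¹ = 1 := by
              have : 2 * (c⁻¹ * (w ⬝ᵥ A *ᵥ e j)) * c⁻¹ = c⁻¹ * c⁻¹ * (2 * (w ⬝ᵥ A *ᵥ e j)) := by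
                ring
              rw [this, hwe, ← hc]; field_simp
            rw [this, one_smul]
          change A *ᵥ e j - (2 * (u ⬝ᵥ (A *ᵥ e j))) • u = e j
          rw [this]; simp [w]
        · have hj' := h j (by simp [hj, hji])
          have : u ⬝ᵥ (A *ᵥ e j) = 0 := by
            simp only [u, w, smul_dotProduct, sub_dotProduct, hdot]
            have : A *ᵥ e j = e j := hj'
            rw [this]; simp
          change A *ᵥ e j - (2 * (u ⬝ᵥ (A *ᵥ e j))) • u = e j
          rw [this, mul_zero, zero_smul, sub_zero]; exact hj'
    have hfin : A = auxH u * (auxH u * A) := by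
      rw [← mul_assoc, auxH_mul_self u hu, one_mul]
    rw [hfin]
    exact Submonoid.mul_mem _ (Submonoid.subset_closure ⟨u, hu, rfl⟩) hA'

theorem aux_rot {n : ℕ} (u w : Fin n → ℝ) (hu : u ⬝ᵥ u = 1) (hw : w ⬝ᵥ w = 1) (huw : u ⬝ᵥ w = 0) :
    ∃ γ : ℝ → SO n, Continuous γ ∧ (∀ s t, γ (s + t) = γ s * γ t) ∧
      ∀ t, ((γ t : orthogonalGroup (Fin n) ℝ) : Matrix (Fin n) (Fin n) ℝ) =
        1 + Real.sin t • (vecMulVec w u - vecMulVec u w) +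
          (Real.cos t - 1) • (vecMulVec u u + vecMulVec w w) := by
  set K := vecMulVec w u - vecMulVec u w with hK
  set P := vecMulVec u u + vecMulVec w w with hP
  have hwu : w ⬝ᵥ u = 0 := by rw [dotProduct_comm, huw]
  have hKK : K * K = -P := by
    simp [hK, hP, sub_mul, mul_sub, vecMulVec_mul_vecMulVec, hu, hw, huw, hwu]
    abel
  have hKP : K * P = K := by
    simp [hK, hP, sub_mul, mul_add, vecMulVec_mul_vecMulVec, hu, hw, huw, hwu]
    abel
  have hPK : P * K = K := by
    simp [hK, hP, add_mul, mul_sub, vecMulVec_mul_vecMulVec, hu, hw, huw, hwu]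
  have hPP : P * P = P := by
    simp [hP, add_mul, mul_add, vecMulVec_mul_vecMulVec, hu, hw, huw, hwu]
  have hKT : Kᵀ = -K := by simp [hK, transpose_vecMulVec]
  have hPT : Pᵀ = P := by simp [hP, transpose_vecMulVec]
  clear_value K P
  let R : ℝ → Matrix (Fin n) (Fin n) ℝ := fun t => 1 + Real.sin t • K + (Real.cos t - 1) • P
  have hRadd : ∀ s t, R (s + t) = R s * R t := by
    intro s t
    simp only [R, add_mul, mul_add, one_mul, mul_one, Matrix.smul_mul, Matrix.mul_smul, hKK, hKP,
      hPK, hPP, Real.sin_add, Real.cos_add]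
    module
  have hR0 : R 0 = 1 := by simp [R]
  have hRT : ∀ t, (R t)ᵀ = R (-t) := by
    intro t
    simp [R, hKT, hPT]
  have hRo : ∀ t, R t ∈ orthogonalGroup (Fin n) ℝ := by
    intro t
    rw [mem_orthogonalGroup_iff]
    change R t * (R t)ᵀ = 1
    rw [hRT, ← hRadd, add_neg_cancel, hR0]
  have hRd : ∀ t, (R t).det = 1 := by
    intro t
    have h1 : R t = R (t/2) * R (t/2) := by rw [← hRadd]; ring_nf
    have h2 := (mem_orthogonalGroup_iff (Fin n) ℝ).1 (hRo (t/2))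
    have h3 : R (t/2) * (R (t/2))ᵀ = 1 := h2
    have h4 := congrArg Matrix.det h3
    rw [det_mul, det_transpose, det_one] at h4
    rw [h1, det_mul, h4]
  refine ⟨fun t => ⟨⟨R t, hRo t⟩, hRd t⟩, ?_, ?_, fun t => rfl⟩
  · refine Continuous.subtype_mk (Continuous.subtype_mk ?_ _) _
    fun_prop
  · intro s t
    apply Subtype.ext; apply Subtype.ext
    exact hRadd s t

theorem aux_gen {n : ℕ} (Hs : Subgroup (SO n))
    (hH : ∀ γ : ℝ → SO n, Continuous γ → (∀ s t, γ (s + t) = γ s * γ t) → ∀ t, γ t ∈ Hs) :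
    Hs = ⊤ := by
  let Q : Matrix (Fin n) (Fin n) ℝ → Prop := fun A => ∃ g ∈ Hs,
    ((g : orthogonalGroup (Fin n) ℝ) : Matrix (Fin n) (Fin n) ℝ) = A
  have hQmul : ∀ A B, Q A → Q B → Q (A * B) := by
    rintro A B ⟨g, hg, rfl⟩ ⟨h, hh, rfl⟩
    exact ⟨g * h, Hs.mul_mem hg hh, rfl⟩
  have hQ1 : Q 1 := ⟨1, Hs.one_mem, rfl⟩
  have hQH : ∀ u v : Fin n → ℝ, u ⬝ᵥ u = 1 → v ⬝ᵥ v = 1 → Q (auxH v * auxH u) := by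
    intro u v hu hv
    let c := u ⬝ᵥ v
    let x := v - c • u
    have hxx : x ⬝ᵥ x = 1 - c ^ 2 := by
      simp only [x, sub_dotProduct, dotProduct_sub, smul_dotProduct, dotProduct_smul, hu, hv,
        dotProduct_comm v u, smul_eq_mul, c]
      ring
    have hux : u ⬝ᵥ x = 0 := by
      simp [x, c, dotProduct_sub, dotProduct_smul, hu]
    have hx0 : 0 ≤ x ⬝ᵥ x := Finset.sum_nonneg fun i _ => mul_self_nonneg _
    by_cases hx : x = 0
    · have hvc : v = c • u := sub_eq_zero.1 hx
      have hc2 : c * c = 1 := by rw [hx] at hxx; simp at hxx; linarith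
      have : auxH v = auxH u := by
        simp only [auxH]
        rw [hvc, smul_vecMulVec, vecMulVec_smul, smul_smul c c, hc2, one_smul]
      rw [this, auxH_mul_self u hu]; exact hQ1
    have hxpos : 0 < x ⬝ᵥ x := lt_of_le_of_ne hx0 fun h => hx (dotProduct_self_eq_zero.1 h.symm)
    let s := √(1 - c ^ 2)
    have hs2 : s ^ 2 = 1 - c ^ 2 := Real.sq_sqrt (by linarith)
    have hs0 : s ≠ 0 := (Real.sqrt_pos.2 (by linarith)).ne'
    let w := s⁻¹ • x
    have hw : w ⬝ᵥ w = 1 := by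
      simp only [w, smul_dotProduct, dotProduct_smul, smul_eq_mul, hxx, ← hs2]
      field_simp
    have huw : u ⬝ᵥ w = 0 := by simp [w, dotProduct_smul, hux]
    have hvw : v = c • u + s • w := by
      simp [w, smul_smul, hs0, x]
    obtain ⟨γ, hγc, hγa, hγ⟩ := aux_rot u w hu hw huw
    refine ⟨γ (2 * Real.arccos c), hH γ hγc hγa _, ?_⟩
    have hcc : Real.cos (Real.arccos c) = c := Real.cos_arccos (by nlinarith) (by nlinarith)
    have hss : Real.sin (Real.arccos c) = s := Real.sin_arccos c
    rw [hγ, Real.sin_two_mul, Real.cos_two_mul, hcc, hss]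
    have hvu : v ⬝ᵥ u = c := dotProduct_comm _ _
    have e1 : auxH v * auxH u = 1 - (2:ℝ) • vecMulVec v v - (2:ℝ) • vecMulVec u u
        + (4 * c) • vecMulVec v u := by
      simp only [auxH, sub_mul, mul_sub, one_mul, mul_one, Matrix.smul_mul, Matrix.mul_smul,
        vecMulVec_mul_vecMulVec, hvu]
      simp only [vecMulVec_smul, smul_vecMulVec]
      module
    rw [e1]
    clear_value c s w x
    subst hvw
    simp only [vecMulVec_smul, smul_vecMulVec, vecMulVec_add, add_vecMulVec]
    ext i j
    simp [vecMulVec_apply]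
    linear_combination (2 * w i * w j) * hs2
  have hR : ∀ A ∈ Submonoid.closure {B | ∃ u : Fin n → ℝ, u ⬝ᵥ u = 1 ∧ B = auxH u},
      (A.det = 1 ∧ Q A) ∨ (A.det = -1 ∧ ∃ u : Fin n → ℝ, u ⬝ᵥ u = 1 ∧ Q (auxH u * A)) := by
    intro A hA
    induction hA using Submonoid.closure_induction_left with
    | one => left; exact ⟨det_one, hQ1⟩
    | mul_left B hB A hA ih =>
      obtain ⟨v, hv, rfl⟩ := hB
      rcases ih with ⟨hd, hq⟩ | ⟨hd, u, hu, hq⟩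
      · right
        refine ⟨by rw [det_mul, hd, auxH_det v hv, mul_one], v, hv, ?_⟩
        rwa [← mul_assoc, auxH_mul_self v hv, one_mul]
      · left
        refine ⟨by rw [det_mul, hd, auxH_det v hv]; norm_num, ?_⟩
        have : auxH v * A = (auxH v * auxH u) * (auxH u * A) := by
          rw [mul_assoc, ← mul_assoc (auxH u), auxH_mul_self u hu, one_mul]
        rw [this]
        exact hQmul _ _ (hQH u v hu hv) hq
  rw [eq_top_iff]
  intro g _
  have hg : ((g : orthogonalGroup (Fin n) ℝ) : Matrix (Fin n) (Fin n) ℝ).det = 1 := g.2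
  have hg2 := (mem_orthogonalGroup_iff' (Fin n) ℝ).1 g.1.2
  rcases hR _ (aux_refl Finset.univ _ hg2 (by simp)) with ⟨_, g', hg', h⟩ | ⟨h, _⟩
  · have : g' = g := Subtype.ext (Subtype.ext h)
    exact this ▸ hg'
  · rw [hg] at h; norm_num at h

end gen
section fin

open Matrix

theorem aux_permInv {N : ℕ} (σ : Equiv.Perm (Fin N)) :
    (σ.permMatrix ℝ)⁻¹ = (σ.permMatrix ℝ)ᵀ ∧ (σ.permMatrix ℝ)ᵀ * σ.permMatrix ℝ = 1 ∧
      σ.permMatrix ℝ * (σ.permMatrix ℝ)ᵀ = 1 := by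
  have h1 : (σ.permMatrix ℝ)ᵀ * σ.permMatrix ℝ = 1 := by
    rw [transpose_permMatrix, ← permMatrix_mul, mul_inv_cancel, permMatrix_one]
  exact ⟨inv_eq_left_inv h1, h1, mul_eq_one_comm.1 h1⟩

/-- Conjugation by a permutation matrix on `SO N`. -/
def auxCj {N : ℕ} (σ : Equiv.Perm (Fin N)) : SO N →* SO N :=
  MonoidHom.mk' (fun g => ⟨⟨(σ.permMatrix ℝ)ᵀ *
      ((g : orthogonalGroup (Fin N) ℝ) : Matrix (Fin N) (Fin N) ℝ) * σ.permMatrix ℝ, by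
        have hg := (mem_orthogonalGroup_iff (Fin N) ℝ).1 g.1.2
        rw [mem_orthogonalGroup_iff]
        change _ * (_)ᵀ = 1
        change _ * (_)ᵀ = 1 at hg
        rw [transpose_mul, transpose_mul, transpose_transpose]
        have h3 := (aux_permInv σ).2.2
        have h2 := (aux_permInv σ).2.1
        generalize σ.permMatrix ℝ = E at *
        calc Eᵀ * g.1.1 * E * (Eᵀ * (g.1.1ᵀ * E)) = Eᵀ * (g.1.1 * (E * Eᵀ) * g.1.1ᵀ) * E := by
              simp only [mul_assoc]
          _ = 1 := by rw [h3, mul_one, hg, mul_one, h2]⟩, by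
        have hg : ((g : orthogonalGroup (Fin N) ℝ) : Matrix (Fin N) (Fin N) ℝ).det = 1 := g.2
        change det (_ * _ * _) = 1
        rw [det_mul, det_mul, hg, mul_one, ← det_mul, (aux_permInv σ).2.1, det_one]⟩)
    (by
      intro a b
      apply Subtype.ext; apply Subtype.ext
      change _ * (a.1.1 * b.1.1) * _ = (_ * a.1.1 * _) * (_ * b.1.1 * _)
      have h3 := (aux_permInv σ).2.2
      generalize σ.permMatrix ℝ = E at *
      calc Eᵀ * (a.1.1 * b.1.1) * E = Eᵀ * a.1.1 * 1 * b.1.1 * E := by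
            simp only [mul_assoc, mul_one, one_mul]
        _ = _ := by rw [← h3]; simp only [mul_assoc])

theorem auxCj_coe {N : ℕ} (σ : Equiv.Perm (Fin N)) (g : SO N) :
    ((auxCj σ g : orthogonalGroup (Fin N) ℝ) : Matrix (Fin N) (Fin N) ℝ) = (σ.permMatrix ℝ)ᵀ *
      ((g : orthogonalGroup (Fin N) ℝ) : Matrix (Fin N) (Fin N) ℝ) * σ.permMatrix ℝ := rfl

/-- The matrices underlying a subgroup of `SO N`. -/
def auxMat {N : ℕ} (G : Subgroup (SO N)) : Submonoid (Matrix (Fin N) (Fin N) ℝ) where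
  carrier := {A | ∃ g ∈ G, ((g : orthogonalGroup (Fin N) ℝ) : Matrix (Fin N) (Fin N) ℝ) = A}
  mul_mem' := by
    rintro A B ⟨g, hg, rfl⟩ ⟨h, hh, rfl⟩
    exact ⟨g * h, G.mul_mem hg hh, rfl⟩
  one_mem' := ⟨1, G.one_mem, rfl⟩

theorem aux_main {N : ℕ} (G : Subgroup (SO N))
    (hconj : ∀ σ, ∀ g ∈ G, auxCj σ g ∈ G)
    (hne : ¬ ∀ γ : ℝ → SO N, Continuous γ → (∀ s t, γ (s + t) = γ s * γ t) → (∀ t, γ t ∈ G) →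
      ∀ t, ((γ t : orthogonalGroup (Fin N) ℝ) : Matrix (Fin N) (Fin N) ℝ) * (Matrix.of fun _ _ => 1)
        = Matrix.of fun _ _ => 1) : G = ⊤ := by
  have hγ0 : ∀ γ : ℝ → SO N, (∀ s t, γ (s + t) = γ s * γ t) → γ 0 = 1 := by
    intro γ h
    have := h 0 0
    rw [add_zero] at this
    exact left_eq_mul.1 this
  have hcoe : Continuous fun g : SO N =>
      ((g : orthogonalGroup (Fin N) ℝ) : Matrix (Fin N) (Fin N) ℝ) :=
    continuous_subtype_val.comp continuous_subtype_val
  obtain ⟨T, hskew, hbr, hcj, hpar, hopen⟩ := aux_packageM (auxMat G)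
    (by
      rintro _ ⟨g, hg, rfl⟩
      exact ⟨g⁻¹, G.inv_mem hg, rfl⟩)
    (by
      rintro _ ⟨g, hg, rfl⟩
      exact (mem_orthogonalGroup_iff (Fin N) ℝ).1 g.1.2)
    (by
      rintro _ ⟨g, hg, rfl⟩
      exact (mem_orthogonalGroup_iff' (Fin N) ℝ).1 g.1.2)
  have hperm : ∀ X ∈ T, ∀ σ : Equiv.Perm (Fin N), X.submatrix σ σ ∈ T := by
    intro X hX σ
    have h1 := hcj ((σ⁻¹).permMatrix ℝ)ᵀ ((σ⁻¹).permMatrix ℝ) (aux_permInv _).2.1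
      (by
        rintro _ ⟨g, hg, rfl⟩
        exact ⟨auxCj σ⁻¹ g, hconj _ g hg, auxCj_coe _ _⟩) X hX
    convert h1 using 1
    rw [transpose_permMatrix, inv_inv, PEquiv.toMatrix_toPEquiv_mul, PEquiv.mul_toMatrix_toPEquiv]
    rfl
  have hex : ∃ X ∈ T, ∃ i, ∑ j, X i j ≠ 0 := by
    by_contra hcon
    push Not at hcon
    apply hne
    intro γ hγc hγa hγG t
    obtain ⟨X, hX, hXv⟩ := hpar (fun t => (γ t).1.1) (hcoe.comp hγc)
      (by simp [hγ0 γ hγa]) (fun s t => by simp [hγa]) (fun t => ⟨γ t, hγG t, rfl⟩)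
    refine hXv _ ?_ t
    ext i j
    simp [Matrix.mul_apply, hcon X hX i]
  obtain ⟨X, hX, i, hXi⟩ := hex
  have hev := hopen (fun Y hY => aux_lin T hskew hbr hperm X hX i hXi Y hY)
  apply aux_gen
  intro γ hγc hγa t
  have hγ1 := hγ0 γ hγa
  have hev2 : ∀ᶠ s in 𝓝 (0:ℝ), γ s ∈ G := by
    have h1 : Tendsto (fun s => (γ s).1.1) (𝓝 0) (𝓝 (1 : Matrix (Fin N) (Fin N) ℝ)) := by
      have := (hcoe.comp hγc).tendsto 0
      simpa [Function.comp_def, hγ1] using this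
    filter_upwards [h1.eventually hev] with s hs
    obtain ⟨g, hg, h⟩ := hs ((mem_orthogonalGroup_iff' (Fin N) ℝ).1 (γ s).1.2)
    have : g = γ s := Subtype.ext (Subtype.ext h)
    exact this ▸ hg
  have hlim : Tendsto (fun m : ℕ => t / ((m : ℝ) + 1)) atTop (𝓝 0) :=
    by simpa [div_eq_mul_inv] using (tendsto_one_div_add_atTop_nhds_zero_nat (𝕜 := ℝ)).const_mul t
  obtain ⟨m, hm⟩ := (hlim.eventually hev2).exists
  have hpow : ∀ (p : ℕ) (s : ℝ), γ (p * s) = γ s ^ p := by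
    intro p s
    induction p with
    | zero => simp [hγ1]
    | succ p ih => rw [pow_succ, ← ih, ← hγa]; congr 1; push_cast; ring
  have : t = ((m + 1 : ℕ) : ℝ) * (t / ((m : ℝ) + 1)) := by
    have : (m : ℝ) + 1 ≠ 0 := by positivity
    push_cast; field_simp
  rw [this, hpow]
  exact G.pow_mem hm _

end fin

theorem statement0 (k N : ℕ) (hk : 3 ≤ k) (hN : 3 ≤ N)
    (φ : SO k →* SO N) (hφcont : Continuous φ)
    (hirr : ¬ ∃ W : Submodule ℝ (Fin N → ℝ), Module.finrank ℝ W = 1 ∧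
      ∀ g : SO k,
        W.map (Matrix.mulVecLin ((φ g : Matrix.orthogonalGroup (Fin N) ℝ) :
          Matrix (Fin N) (Fin N) ℝ)) = W) :
    Subgroup.closure {x : SO N |
      ∃ (g : SO k) (σ : Equiv.Perm (Fin N)),
        ((x : Matrix.orthogonalGroup (Fin N) ℝ) : Matrix (Fin N) (Fin N) ℝ) =
          (σ.permMatrix ℝ)⁻¹ *
            ((φ g : Matrix.orthogonalGroup (Fin N) ℝ) : Matrix (Fin N) (Fin N) ℝ) *
            σ.permMatrix ℝ} = ⊤ := by
  apply aux_main
  · intro τ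
    refine (Subgroup.closure_le (K := (Subgroup.closure _).comap (auxCj τ))).2 ?_
    rintro x ⟨g, σ, hx⟩
    refine Subgroup.subset_closure ⟨g, τ * σ, ?_⟩
    rw [auxCj_coe, hx, (aux_permInv _).1, (aux_permInv _).1, permMatrix_mul, transpose_mul]
    simp only [mul_assoc]
  · intro hcon
    apply hirr
    let o : Fin N → ℝ := fun _ => 1
    have hfix : ∀ g : SO k, ((φ g : orthogonalGroup (Fin N) ℝ) : Matrix (Fin N) (Fin N) ℝ) *
        (Matrix.of fun _ _ => 1) = Matrix.of fun _ _ => 1 := by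
      let Hs : Subgroup (SO k) :=
        { carrier := {g | ((φ g : orthogonalGroup (Fin N) ℝ) : Matrix (Fin N) (Fin N) ℝ) *
            (Matrix.of fun _ _ => 1) = Matrix.of fun _ _ => 1}
          mul_mem' := by
            intro a b ha hb
            change ((φ (a * b) : orthogonalGroup (Fin N) ℝ) : Matrix (Fin N) (Fin N) ℝ) * _ = _
            rw [map_mul]
            change (φ a).1.1 * (φ b).1.1 * _ = _
            change (φ a).1.1 * _ = _ at ha
            change (φ b).1.1 * _ = _ at hb
            rw [mul_assoc, hb, ha]
          one_mem' := by
            change ((φ 1 : orthogonalGroup (Fin N) ℝ) : Matrix (Fin N) (Fin N) ℝ) * _ = _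
            rw [map_one]
            exact one_mul _
          inv_mem' := by
            intro a ha
            change (φ a).1.1 * _ = _ at ha
            change ((φ a⁻¹ : orthogonalGroup (Fin N) ℝ) : Matrix (Fin N) (Fin N) ℝ) * _ = _
            rw [map_inv]
            have h1 : ((φ a)⁻¹).1.1 * (φ a).1.1 = 1 :=
              (mem_orthogonalGroup_iff' (Fin N) ℝ).1 (φ a).1.2
            rw [← ha, ← mul_assoc, h1, one_mul, ha] }
      have hH : Hs = ⊤ := by
        apply aux_gen
        intro γ hγc hγa t
        refine hcon (fun t => φ (γ t)) (hφcont.comp hγc) (fun s t => by rw [hγa, map_mul]) ?_ t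
        intro t
        refine Subgroup.subset_closure ⟨γ t, 1, ?_⟩
        simp
      intro g
      have : g ∈ Hs := hH ▸ Subgroup.mem_top g
      exact this
    have hpos : 0 < N := by omega
    have ho : o ≠ 0 := fun h => one_ne_zero (congrFun h ⟨0, hpos⟩)
    refine ⟨Submodule.span ℝ {o}, finrank_span_singleton ho, fun g => ?_⟩
    rw [Submodule.map_span, Set.image_singleton]
    congr 2
    ext i
    have := congrFun (congrFun (hfix g) i) ⟨0, hpos⟩
    simpa [Matrix.mul_apply, Matrix.mulVec, dotProduct, o] using this
end

section
/- Let k ≥ 3 and N ≥ 3, and let φ : SO(k) → SO(N) be a continuous group homomorphism such that no one-dimensional linear subspace of ℝ^N is invariant under φ(g) for all g ∈ SO(k). Let σ₀ ∈ S_N be a fixed permutation of sign −1. Then the subgroup of the orthogonal group O(N) generated by the matrix E_{σ₀} together with all matrices E_σ⁻¹ φ(g) E_σ, for g ∈ SO(k) and σ ∈ S_N, is all of O(N). -/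
open Matrix

section helpers

open scoped Matrix.Norms.Operator

/-- reflection matrix -/
noncomputable def reflM {n : ℕ} (v : Fin n → ℝ) : Matrix (Fin n) (Fin n) ℝ :=
  1 - (2 : ℝ) • Matrix.vecMulVec v v

/-- rotation matrix in the plane spanned by the orthonormal pair `u, w` -/
noncomputable def rotM {n : ℕ} (u w : Fin n → ℝ) (t : ℝ) : Matrix (Fin n) (Fin n) ℝ :=
  1 + (Real.cos t - 1) • (vecMulVec u u + vecMulVec w w) +
    Real.sin t • (vecMulVec w u - vecMulVec u w)

lemma vmv_mul {n : ℕ} (a b c d : Fin n → ℝ) :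
    vecMulVec a b * vecMulVec c d = (b ⬝ᵥ c) • vecMulVec a d := by
  rw [vecMulVec_mul_vecMulVec]
  ext i j
  simp [vecMulVec_apply]; ring

lemma rotM_mul {n : ℕ} (u w : Fin n → ℝ) (hu : u ⬝ᵥ u = 1) (hw : w ⬝ᵥ w = 1)
    (huw : u ⬝ᵥ w = 0) (s t : ℝ) : rotM u w s * rotM u w t = rotM u w (s + t) := by
  have hwu : w ⬝ᵥ u = 0 := by rw [dotProduct_comm]; exact huw
  simp only [rotM, add_mul, mul_add, sub_mul, mul_sub, smul_mul_assoc, mul_smul_comm, one_mul,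
    mul_one, vmv_mul, hu, hw, huw, hwu, Real.cos_add, Real.sin_add, smul_add, smul_sub]
  module

lemma rotM_zero {n : ℕ} (u w : Fin n → ℝ) : rotM u w 0 = 1 := by
  simp [rotM]

lemma rotM_transpose {n : ℕ} (u w : Fin n → ℝ) (t : ℝ) : (rotM u w t)ᵀ = rotM u w (-t) := by
  simp only [rotM, transpose_add, transpose_smul, transpose_sub, transpose_one,
    transpose_vecMulVec, Real.cos_neg, Real.sin_neg]
  module

lemma rotM_mem {n : ℕ} (u w : Fin n → ℝ) (hu : u ⬝ᵥ u = 1) (hw : w ⬝ᵥ w = 1)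
    (huw : u ⬝ᵥ w = 0) (t : ℝ) : rotM u w t ∈ Matrix.orthogonalGroup (Fin n) ℝ := by
  rw [Matrix.mem_orthogonalGroup_iff]
  change rotM u w t * (rotM u w t)ᵀ = 1
  rw [rotM_transpose, rotM_mul u w hu hw huw, add_neg_cancel, rotM_zero]

lemma rotM_det {n : ℕ} (u w : Fin n → ℝ) (hu : u ⬝ᵥ u = 1) (hw : w ⬝ᵥ w = 1)
    (huw : u ⬝ᵥ w = 0) (t : ℝ) : (rotM u w t).det = 1 := by
  have h1 : rotM u w t = rotM u w (t/2) * rotM u w (t/2) := by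
    rw [rotM_mul u w hu hw huw, add_halves]
  have h2 := (Matrix.mem_orthogonalGroup_iff _ _).1 (rotM_mem u w hu hw huw (t/2))
  have h3 := congrArg Matrix.det h2
  rw [det_mul, det_transpose, det_one] at h3
  rw [h1, det_mul]
  simpa using h3

lemma rotM_continuous {n : ℕ} (u w : Fin n → ℝ) : Continuous (rotM u w) := by
  unfold rotM
  fun_prop

lemma reflM_det {n : ℕ} (v : Fin n → ℝ) (hv : v ⬝ᵥ v = 1) : (reflM v).det = -1 := by
  have : reflM v = 1 + vecMulVec ((-2 : ℝ) • v) v := by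
    rw [reflM, smul_vecMulVec]; module
  rw [this, vecMulVec_eq Unit, det_one_add_replicateCol_mul_replicateRow]
  simp [hv]; norm_num

/-- the product of two reflections is a rotation -/
lemma reflM_mul_reflM {n : ℕ} (u v : Fin n → ℝ) (hu : u ⬝ᵥ u = 1) (hv : v ⬝ᵥ v = 1) :
    reflM u * reflM v = 1 ∨ ∃ (w : Fin n → ℝ) (t : ℝ), w ⬝ᵥ w = 1 ∧ u ⬝ᵥ w = 0 ∧
      reflM u * reflM v = rotM u w t := by
  set c := u ⬝ᵥ v with hc
  set z := v - c • u with hz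
  have hvu : v ⬝ᵥ u = c := by rw [dotProduct_comm]
  have huz : u ⬝ᵥ z = 0 := by simp [hz, dotProduct_sub, hu, ← hc]
  have hzz : z ⬝ᵥ z = 1 - c ^ 2 := by
    simp only [hz, dotProduct_sub, sub_dotProduct, dotProduct_smul, smul_dotProduct, hu, hv, hvu,
      ← hc, smul_eq_mul]; ring
  have hvz : v = c • u + z := by rw [hz]; module
  by_cases h0 : z = 0
  · left
    have hc2 : c * c = 1 := by rw [h0] at hzz; simp at hzz; linarith
    rw [h0, add_zero] at hvz
    have : reflM v = reflM u := by
      rw [reflM, reflM, hvz, smul_vecMulVec, vecMulVec_smul, smul_smul, smul_smul, mul_assoc, hc2, mul_one]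
    rw [this]
    simp only [reflM, mul_sub, sub_mul, one_mul, mul_one, smul_mul_assoc, mul_smul_comm, vmv_mul,
      hu]
    module
  · right
    have hpos : 0 < z ⬝ᵥ z := by
      have h1 : 0 ≤ z ⬝ᵥ z := by
        simpa using dotProduct_star_self_nonneg z
      have h2 : z ⬝ᵥ z ≠ 0 := fun h => h0 (dotProduct_self_eq_zero.1 h)
      exact lt_of_le_of_ne h1 (Ne.symm h2)
    have hc1 : -1 ≤ c := by nlinarith
    have hc2 : c ≤ 1 := by nlinarith
    set s := Real.sqrt (1 - c ^ 2) with hs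
    have hs2 : s * s = 1 - c ^ 2 := Real.mul_self_sqrt (by linarith)
    have hs0 : s ≠ 0 := by
      intro h; rw [h] at hs2; linarith
    refine ⟨s⁻¹ • z, -(2 * Real.arccos c), ?_, ?_, ?_⟩
    · simp only [dotProduct_smul, smul_dotProduct, smul_eq_mul, hzz, ← hs2]
      field_simp
    · simp [huz]
    · have hvw : v = c • u + s • (s⁻¹ • z) := by
        rw [smul_smul, mul_inv_cancel₀ hs0, one_smul]; exact hvz
      have huw : u ⬝ᵥ (s⁻¹ • z) = 0 := by simp [huz]
      generalize s⁻¹ • z = w at hvw huw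
      have e1 : Real.cos (-(2 * Real.arccos c)) = 2 * c ^ 2 - 1 := by
        rw [Real.cos_neg, Real.cos_two_mul, Real.cos_arccos hc1 hc2]
      have e2 : Real.sin (-(2 * Real.arccos c)) = - (2 * s * c) := by
        rw [Real.sin_neg, Real.sin_two_mul, Real.cos_arccos hc1 hc2, Real.sin_arccos]
      rw [rotM, e1, e2, reflM, reflM, hvw]
      simp only [vecMulVec_add, add_vecMulVec, smul_vecMulVec, vecMulVec_smul, mul_sub, sub_mul,
        one_mul, mul_one, smul_mul_assoc, mul_smul_comm, vmv_mul, mul_add, hu, huw, smul_add,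
        smul_sub, smul_smul]
      have e3 : s ^ 2 = 1 - c ^ 2 := by rw [sq]; exact hs2
      match_scalars <;> first | linear_combination (0:ℝ) * e3 | linear_combination (-2:ℝ) * e3

lemma cartan_aux {n : ℕ} (l : List (EuclideanSpace ℝ (Fin n))) :
    ∃ l' : List (Fin n → ℝ), (∀ v ∈ l', v ⬝ᵥ v = 1) ∧
      ∀ x : EuclideanSpace ℝ (Fin n),
        (((l.map fun v => Submodule.reflection (Submodule.span ℝ {v})ᗮ).prod x :
          EuclideanSpace ℝ (Fin n)) : Fin n → ℝ) = (l'.map reflM).prod *ᵥ (x : Fin n → ℝ) := by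
  induction l with
  | nil => exact ⟨[], by simp, by simp⟩
  | cons v l ih =>
    obtain ⟨l', h1, h2⟩ := ih
    by_cases hv : v = 0
    · refine ⟨l', h1, fun x => ?_⟩
      rw [← h2]
      subst hv
      rw [List.map_cons, List.prod_cons, LinearIsometryEquiv.coe_mul, Function.comp_apply,
        Submodule.reflection_orthogonal_apply, Submodule.reflection_singleton_apply]
      simp
    · have hn : ‖v‖ ≠ 0 := norm_ne_zero_iff.2 hv
      have hvv : (v : Fin n → ℝ) ⬝ᵥ (v : Fin n → ℝ) = ‖v‖ ^ 2 := by
        rw [← real_inner_self_eq_norm_sq, EuclideanSpace.inner_eq_star_dotProduct]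
        simp
      refine ⟨(‖v‖⁻¹ • (v : Fin n → ℝ)) :: l', ?_, fun x => ?_⟩
      · intro w hw
        rcases List.mem_cons.1 hw with rfl | hw
        · rw [dotProduct_smul, smul_dotProduct, hvv]
          simp only [smul_eq_mul]
          field_simp
        · exact h1 w hw
      · rw [List.map_cons, List.prod_cons, List.map_cons, List.prod_cons, ← Matrix.mulVec_mulVec,
          ← h2, LinearIsometryEquiv.coe_mul, Function.comp_apply]
        generalize (List.map (fun v => (Submodule.span ℝ {v})ᗮ.reflection) l).prod x = y
        rw [Submodule.reflection_orthogonal_apply, Submodule.reflection_singleton_apply]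
        have hvy : inner ℝ v y = (v : Fin n → ℝ) ⬝ᵥ (y : Fin n → ℝ) := by
          rw [EuclideanSpace.inner_eq_star_dotProduct, dotProduct_comm]
          simp
        rw [hvy]
        simp only [reflM, sub_mulVec, one_mulVec, smul_mulVec, vecMulVec_mulVec, smul_dotProduct]
        ext i
        simp
        field_simp

lemma cartan {n : ℕ} (A : Matrix (Fin n) (Fin n) ℝ) (hA : A ∈ Matrix.orthogonalGroup (Fin n) ℝ) :
    ∃ l : List (Fin n → ℝ), (∀ v ∈ l, v ⬝ᵥ v = 1) ∧ A = (l.map reflM).prod := by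
  have hA' : Aᵀ * A = 1 := (Matrix.mem_orthogonalGroup_iff' _ _).1 hA
  let f : EuclideanSpace ℝ (Fin n) →ₗ[ℝ] EuclideanSpace ℝ (Fin n) := Matrix.toLpLin 2 2 A
  have hf : ∀ x y, inner ℝ (f x) (f y) = inner ℝ x y := by
    intro x y
    simp only [f, EuclideanSpace.inner_eq_star_dotProduct, Matrix.toLpLin_apply, star_trivial]
    rw [← Matrix.vecMul_transpose, ← Matrix.dotProduct_mulVec, Matrix.mulVec_mulVec, hA',
      Matrix.one_mulVec]
  let F := (f.isometryOfInner hf).toLinearIsometryEquiv rfl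
  obtain ⟨l, -, hl⟩ := LinearIsometryEquiv.reflections_generate_dim F
  obtain ⟨l', h1, h2⟩ := cartan_aux l
  refine ⟨l', h1, ?_⟩
  rw [← hl] at h2
  apply Matrix.ext_of_mulVec_single
  intro i
  rw [← h2 (WithLp.toLp 2 (Pi.single i 1))]
  simp [F, f]

/-- a subgroup of `O(n)` containing all plane rotations contains `SO(n)` -/
lemma SO_le_of_rot {n : ℕ} (K : Subgroup (Matrix.orthogonalGroup (Fin n) ℝ))
    (hK : ∀ (u w : Fin n → ℝ) (hu : u ⬝ᵥ u = 1) (hw : w ⬝ᵥ w = 1) (huw : u ⬝ᵥ w = 0) (t : ℝ),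
      (⟨rotM u w t, rotM_mem u w hu hw huw t⟩ : Matrix.orthogonalGroup (Fin n) ℝ) ∈ K) :
    SO n ≤ K := by
  have key : ∀ m : ℕ, ∀ l : List (Fin n → ℝ), l.length = 2 * m → (∀ v ∈ l, v ⬝ᵥ v = 1) →
      ∃ A ∈ K, (A : Matrix (Fin n) (Fin n) ℝ) = (l.map reflM).prod := by
    intro m
    induction m with
    | zero =>
      intro l hl _
      have : l = [] := List.length_eq_zero_iff.1 (by simpa using hl)
      subst this
      exact ⟨1, K.one_mem, by simp⟩
    | succ m ih =>
      intro l hl hv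
      match l, hl, hv with
      | u :: v :: l, hl, hv =>
        obtain ⟨A, hA, hA'⟩ := ih l (by simp at hl; omega) (fun w hw => hv w (by simp [hw]))
        have hu : u ⬝ᵥ u = 1 := hv u (by simp)
        have hv : v ⬝ᵥ v = 1 := hv v (by simp)
        rcases reflM_mul_reflM u v hu hv with h | ⟨w, t, hw, huw, h⟩
        · refine ⟨A, hA, ?_⟩
          simp [← mul_assoc, h, hA']
        · refine ⟨_, K.mul_mem (hK u w hu hw huw t) hA, ?_⟩
          simp [← mul_assoc, h, hA']
      | [u], hl, _ => simp at hl; omega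
      | [], hl, _ => simp at hl
  intro A hA
  obtain ⟨l, hl, hA2⟩ := cartan A.1 A.2
  have hdet : ∀ l : List (Fin n → ℝ), (∀ v ∈ l, v ⬝ᵥ v = 1) →
      (l.map reflM).prod.det = (-1 : ℝ) ^ l.length := by
    intro l
    induction l with
    | nil => simp
    | cons v l ih =>
      intro h
      rw [List.map_cons, List.prod_cons, det_mul, ih (fun w hw => h w (by simp [hw])),
        reflM_det v (h v (by simp)), List.length_cons, pow_succ]
      ring
  have hA1 : (A : Matrix (Fin n) (Fin n) ℝ).det = 1 := hA
  rw [hA2, hdet l hl] at hA1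
  have hev : Even l.length := by
    by_contra h
    rw [Nat.not_even_iff_odd] at h
    rw [h.neg_one_pow] at hA1
    norm_num at hA1
  obtain ⟨m, hm⟩ := hev
  obtain ⟨B, hB, hB2⟩ := key m l (by omega) hl
  have : A = B := Subtype.ext (by rw [hA2, hB2])
  rw [this]; exact hB

/-- a subgroup of `O(n)` which contains a neighbourhood of one contains `SO(n)` -/
lemma SO_le_of_nhds {n : ℕ} (K : Subgroup (Matrix.orthogonalGroup (Fin n) ℝ))
    (U : Set (Matrix (Fin n) (Fin n) ℝ)) (hU : U ∈ nhds 1)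
    (hK : ∀ A : Matrix.orthogonalGroup (Fin n) ℝ, (A : Matrix (Fin n) (Fin n) ℝ) ∈ U → A ∈ K) :
    SO n ≤ K := by
  apply SO_le_of_rot
  intro u w hu hw huw t
  have h1 : Filter.Tendsto (fun m : ℕ => rotM u w (t / (m + 1 : ℕ))) Filter.atTop (nhds 1) := by
    have h2 : Filter.Tendsto (rotM u w) (nhds 0) (nhds 1) := by
      rw [← rotM_zero u w]; exact (rotM_continuous u w).tendsto 0
    have h3 : Filter.Tendsto (fun m : ℕ => t / ((m + 1 : ℕ) : ℝ)) Filter.atTop (nhds 0) :=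
      (Filter.tendsto_add_atTop_iff_nat 1).2 (tendsto_const_div_atTop_nhds_zero_nat t)
    exact h2.comp h3
  obtain ⟨m, hm⟩ := (h1.eventually hU).exists
  have h4 := K.pow_mem (hK ⟨_, rotM_mem u w hu hw huw (t / (m + 1 : ℕ))⟩ hm) (m + 1)
  have h5 : ∀ (s : ℝ) (j : ℕ), rotM u w s ^ j = rotM u w (j * s) := by
    intro s j
    induction j with
    | zero => simp [rotM_zero]
    | succ j ih => rw [pow_succ, ih, rotM_mul u w hu hw huw]; congr 1; push_cast; ring
  convert h4
  rw [SubmonoidClass.coe_pow, h5]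
  congr 1
  field_simp

/-- square real matrices -/
abbrev Mat (n : ℕ) := Matrix (Fin n) (Fin n) ℝ

lemma strictF_mul_of_one {A E : Type*} [NormedRing A] [NormedAlgebra ℝ A] [NormedAddCommGroup E]
    [NormedSpace ℝ E] {f g : E → A} {f' g' : E →L[ℝ] A} {x : E} (hf : HasStrictFDerivAt f f' x)
    (hg : HasStrictFDerivAt g g' x) (hf1 : f x = 1) (hg1 : g x = 1) :
    HasStrictFDerivAt (fun y => f y * g y) (f' + g') x := by
  have := hf.mul' hg
  rw [hf1, hg1] at this
  refine HasStrictFDerivAt.congr_fderiv this ?_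
  ext t
  simp [add_comm]

lemma strict_mul_of_one {A : Type*} [NormedRing A] [NormedAlgebra ℝ A]
    {f g : ℝ → A} {f' g' : A} {x : ℝ} (hf : HasStrictDerivAt f f' x)
    (hg : HasStrictDerivAt g g' x) (hf1 : f x = 1) (hg1 : g x = 1) :
    HasStrictDerivAt (fun y => f y * g y) (f' + g') x := by
  have := hf.mul hg
  rw [hf1, hg1, mul_one, one_mul] at this
  exact this

lemma strict_conj {A : Type*} [NormedRing A] [NormedAlgebra ℝ A]
    {f g : ℝ → A} {f' g' Y : A} {x : ℝ} (hf : HasStrictDerivAt f f' x)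
    (hg : HasStrictDerivAt g g' x) (hf1 : f x = 1) (hg1 : g x = 1) :
    HasStrictDerivAt (fun y => f y * Y * g y) (f' * Y + Y * g') x := by
  have := (hf.mul_const Y).mul hg
  rw [hf1, hg1, mul_one, one_mul] at this
  exact this

/-- tangent vectors at one to a subgroup of `O(n)` -/
def IsTan {n : ℕ} (H : Subgroup (Matrix.orthogonalGroup (Fin n) ℝ))
    (X : Matrix (Fin n) (Fin n) ℝ) : Prop :=
  ∃ c : ℝ → Matrix.orthogonalGroup (Fin n) ℝ, (∀ t, c t ∈ H) ∧ c 0 = 1 ∧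
    HasStrictDerivAt (fun t => (c t : Matrix (Fin n) (Fin n) ℝ)) X 0

lemma IsTan.add {n : ℕ} {H : Subgroup (Matrix.orthogonalGroup (Fin n) ℝ)}
    {X Y : Matrix (Fin n) (Fin n) ℝ} (hX : IsTan H X) (hY : IsTan H Y) : IsTan H (X + Y) := by
  obtain ⟨c, h1, h2, h3⟩ := hX
  obtain ⟨d, k1, k2, k3⟩ := hY
  refine ⟨fun t => c t * d t, fun t => H.mul_mem (h1 t) (k1 t), by simp [h2, k2], ?_⟩
  exact strict_mul_of_one h3 k3 (by simp [h2]) (by simp [k2])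

lemma IsTan.smul {n : ℕ} {H : Subgroup (Matrix.orthogonalGroup (Fin n) ℝ)}
    {X : Matrix (Fin n) (Fin n) ℝ} (r : ℝ) (hX : IsTan H X) : IsTan H (r • X) := by
  obtain ⟨c, h1, h2, h3⟩ := hX
  refine ⟨fun t => c (r * t), fun t => h1 _, by simp [h2], ?_⟩
  have h4 : HasStrictDerivAt (fun t : ℝ => r * t) r 0 := by
    simpa using (hasStrictDerivAt_id (0:ℝ)).const_mul r
  have h3' : HasStrictDerivAt (fun t => (c t : Matrix (Fin n) (Fin n) ℝ)) X (r * 0) := by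
    simpa using h3
  exact h3'.scomp (0:ℝ) h4

/-- the tangent space at one -/
def tanSp {n : ℕ} (H : Subgroup (Matrix.orthogonalGroup (Fin n) ℝ)) :
    Submodule ℝ (Matrix (Fin n) (Fin n) ℝ) where
  carrier := {X | IsTan H X}
  add_mem' := fun h k => IsTan.add h k
  zero_mem' := ⟨fun _ => 1, fun _ => H.one_mem, rfl, hasStrictDerivAt_const _ _⟩
  smul_mem' := fun r _ h => IsTan.smul r h

lemma hasStrictDerivAt_transpose {n : ℕ} {c : ℝ → Matrix (Fin n) (Fin n) ℝ}
    {X : Matrix (Fin n) (Fin n) ℝ} {t : ℝ} (h : HasStrictDerivAt c X t) :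
    HasStrictDerivAt (fun t => (c t)ᵀ) Xᵀ t := by
  let T : Matrix (Fin n) (Fin n) ℝ →L[ℝ] Matrix (Fin n) (Fin n) ℝ :=
    LinearMap.toContinuousLinearMap (Matrix.transposeLinearEquiv (Fin n) (Fin n) ℝ ℝ).toLinearMap
  exact T.hasStrictFDerivAt.comp_hasStrictDerivAt t h

lemma IsTan.skew {n : ℕ} {H : Subgroup (Matrix.orthogonalGroup (Fin n) ℝ)}
    {X : Matrix (Fin n) (Fin n) ℝ} (hX : IsTan H X) : Xᵀ = -X := by
  obtain ⟨c, h1, h2, h3⟩ := hX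
  have h4 := strict_mul_of_one h3 (hasStrictDerivAt_transpose h3) (by simp [h2]) (by simp [h2])
  have h5 : (fun t => (c t : Matrix (Fin n) (Fin n) ℝ) * (c t : Matrix (Fin n) (Fin n) ℝ)ᵀ)
      = fun _ => 1 := by
    funext t
    exact (Matrix.mem_orthogonalGroup_iff _ _).1 (c t).2
  have h6 := h4.hasDerivAt.unique (by
    change HasDerivAt (fun t => (c t : Matrix (Fin n) (Fin n) ℝ) *
      (c t : Matrix (Fin n) (Fin n) ℝ)ᵀ) 0 0
    rw [h5]; exact hasDerivAt_const _ _)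
  exact eq_neg_of_add_eq_zero_right h6

lemma tanSp_bracket {n : ℕ} {H : Subgroup (Matrix.orthogonalGroup (Fin n) ℝ)}
    {X Y : Matrix (Fin n) (Fin n) ℝ} (hX : X ∈ tanSp H) (hY : Y ∈ tanSp H) :
    X * Y - Y * X ∈ tanSp H := by
  have hsk := IsTan.skew hX
  obtain ⟨c, h1, h2, h3⟩ := hX
  have hmem : ∀ t, (c t : Matrix (Fin n) (Fin n) ℝ) * Y * (c t : Matrix (Fin n) (Fin n) ℝ)ᵀ
      ∈ tanSp H := by
    intro t
    obtain ⟨d, k1, k2, k3⟩ := hY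
    refine ⟨fun s => c t * d s * (c t)⁻¹, fun s => H.mul_mem (H.mul_mem (h1 t) (k1 s))
      (H.inv_mem (h1 t)), by simp [k2], ?_⟩
    exact (k3.const_mul _).mul_const _
  have hd : HasDerivAt (fun t => (c t : Matrix (Fin n) (Fin n) ℝ) * Y *
      (c t : Matrix (Fin n) (Fin n) ℝ)ᵀ) (X * Y - Y * X) 0 := by
    have := (strict_conj (Y := Y) h3 (hasStrictDerivAt_transpose h3) (by simp [h2])
      (by simp [h2])).hasDerivAt
    rw [hsk, mul_neg, ← sub_eq_add_neg] at this
    exact this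
  have hcl : IsClosed (tanSp H : Set (Matrix (Fin n) (Fin n) ℝ)) :=
    Submodule.closed_of_finiteDimensional _
  refine hcl.mem_of_tendsto (hasDerivAt_iff_tendsto_slope.1 hd) (Filter.Eventually.of_forall ?_)
  intro t
  rw [slope_def_module]
  exact (tanSp H).smul_mem _ ((tanSp H).sub_mem (hmem _) (hmem _))

lemma prod_path {n : ℕ} (H : Subgroup (Matrix.orthogonalGroup (Fin n) ℝ)) {ι : Type} [Fintype ι]
    [DecidableEq ι]
    (X : ι → Matrix (Fin n) (Fin n) ℝ) (hX : ∀ i, X i ∈ tanSp H) (S : Finset ι) :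
    ∃ f : (ι → ℝ) → Matrix.orthogonalGroup (Fin n) ℝ, (∀ t, f t ∈ H) ∧ f 0 = 1 ∧
      ∃ f' : (ι → ℝ) →L[ℝ] Matrix (Fin n) (Fin n) ℝ,
      HasStrictFDerivAt (fun t => (f t : Matrix (Fin n) (Fin n) ℝ)) f' 0 ∧
      ∀ t, f' t = ∑ i ∈ S, t i • X i := by
  induction S using Finset.induction_on with
  | empty => exact ⟨fun _ => 1, fun _ => H.one_mem, rfl, 0, hasStrictFDerivAt_const _ _, by simp⟩
  | insert a S ha ih =>
    obtain ⟨f, h1, h2, f', h3, h4⟩ := ih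
    obtain ⟨c, k1, k2, k3⟩ := hX a
    let p : (ι → ℝ) →L[ℝ] ℝ := ContinuousLinearMap.proj a
    have k4 : HasStrictFDerivAt (fun t : ι → ℝ => (c (t a) : Matrix (Fin n) (Fin n) ℝ))
        ((ContinuousLinearMap.toSpanSingleton ℝ (X a)).comp p) 0 := by
      have k3' : HasStrictFDerivAt (fun t => (c t : Matrix (Fin n) (Fin n) ℝ))
        (ContinuousLinearMap.toSpanSingleton ℝ (X a)) (p 0) := by
        rw [map_zero]; exact k3.hasStrictFDerivAt
      exact k3'.comp 0 p.hasStrictFDerivAt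
    refine ⟨fun t => c (t a) * f t, fun t => H.mul_mem (k1 _) (h1 t), by simp [h2, k2], _,
      strictF_mul_of_one k4 h3 (by simp [k2]) (by simp [h2]), ?_⟩
    intro t
    rw [Finset.sum_insert ha, ← h4]
    rfl

lemma nhds_of_tan {n : ℕ} (H : Subgroup (Matrix.orthogonalGroup (Fin n) ℝ))
    (hH : ∀ i j, (Matrix.single i j 1 - Matrix.single j i 1 : Matrix (Fin n) (Fin n) ℝ)
      ∈ tanSp H) : SO n ≤ H := by
  obtain ⟨f, h1, h2, f', h3, h4⟩ := prod_path H (ι := Fin n × Fin n)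
    (fun p => Matrix.single p.1 p.2 1 - Matrix.single p.2 p.1 1) (fun p => hH p.1 p.2) Finset.univ
  let T : Mat n →L[ℝ] Mat n :=
    LinearMap.toContinuousLinearMap (Matrix.transposeLinearEquiv (Fin n) (Fin n) ℝ ℝ).toLinearMap
  have hT : ∀ Z : Mat n, T Z = Zᵀ := fun Z => rfl
  let Q : ((Fin n × Fin n → ℝ) × Mat n) →L[ℝ] Mat n := (ContinuousLinearMap.id ℝ (Mat n) + T).comp (ContinuousLinearMap.snd ℝ _ _)
  have hQ : HasStrictFDerivAt (fun p : ((Fin n × Fin n → ℝ) × Mat n) => (1 : Mat n) + Q p) Q 0 :=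
    Q.hasStrictFDerivAt.const_add 1
  let P : ((Fin n × Fin n → ℝ) × Mat n) →L[ℝ] (Fin n × Fin n → ℝ) :=
    ContinuousLinearMap.fst ℝ _ _
  have hf : HasStrictFDerivAt (fun p : (Fin n × Fin n → ℝ) × Mat n => (f p.1 : Mat n))
      (f'.comp P) 0 := by
    have h3' : HasStrictFDerivAt (fun t => (f t : Mat n)) f' (P 0) := h3
    exact h3'.comp 0 P.hasStrictFDerivAt
  have hF := strictF_mul_of_one hf hQ (by simp [h2]) (by simp)
  have hsurj : (f'.comp P + Q).range = ⊤ := by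
    rw [LinearMap.range_eq_top]
    intro B
    refine ⟨(fun p => B p.1 p.2 / 2, (1/2 : ℝ) • B), ?_⟩
    have e1 : ∑ p : Fin n × Fin n, (B p.1 p.2 / 2) •
        (Matrix.single p.1 p.2 1 - Matrix.single p.2 p.1 1 : Mat n) = (1/2 : ℝ) • (B - Bᵀ) := by
      have e2 : ∀ B : Mat n, ∑ p : Fin n × Fin n, (B p.1 p.2 / 2) • (Matrix.single p.1 p.2 1 : Mat n)
          = (1/2:ℝ) • B := by
        intro B
        rw [Fintype.sum_prod_type]
        conv_rhs => rw [Matrix.matrix_eq_sum_single B]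
        simp [Finset.smul_sum, div_eq_inv_mul]
      simp only [smul_sub, Finset.sum_sub_distrib]
      rw [e2]
      congr 1
      rw [← e2 Bᵀ, ← (Equiv.prodComm (Fin n) (Fin n)).sum_comp]
      simp
    change f' (fun p => B p.1 p.2 / 2) + ((1/2 : ℝ) • B + ((1/2 : ℝ) • B)ᵀ) = B
    rw [h4, e1, transpose_smul]
    module
  have hmap := hF.map_nhds_eq_of_surj hsurj
  have hU : {p : ((Fin n × Fin n → ℝ) × Mat n) | ‖p.2 + p.2ᵀ‖ < 1} ∈ nhds (0 : ((Fin n × Fin n → ℝ) × Mat n)) := by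
    apply IsOpen.mem_nhds
    · apply isOpen_lt _ continuous_const
      fun_prop
    · simp
  have hV := Filter.image_mem_map (m := fun p : ((Fin n × Fin n → ℝ) × Mat n) => (f p.1 : Mat n) * (1 + Q p)) hU
  replace hV := hmap.ge hV
  have h10 : (f ((0 : (Fin n × Fin n → ℝ) × Mat n).1) : Mat n) * (1 + Q 0) = 1 := by simp [h2]
  rw [h10] at hV
  refine SO_le_of_nhds H _ hV ?_
  rintro A ⟨p, hp, hpA⟩
  set S := Q p with hS
  have hSS : Q p = p.2 + p.2ᵀ := rfl
  have hSn : ‖S‖ < 1 := hp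
  have hSt : Sᵀ = S := by rw [hS, hSS]; simp [add_comm]
  have hort : (1 + S) * (1 + S) = 1 := by
    have e : (1 + S) = (((f p.1)⁻¹ * A : Matrix.orthogonalGroup (Fin n) ℝ) : Mat n) := by
      rw [Submonoid.coe_mul, ← hpA]
      simp only []
      rw [← mul_assoc, ← Submonoid.coe_mul, inv_mul_cancel]; simp [hS]
    have e2 := (Matrix.mem_orthogonalGroup_iff _ _).1 ((f p.1)⁻¹ * A).2
    rw [← e] at e2
    simpa [star_eq_conjTranspose, hSt] using e2
  have h2S : (2:ℝ) • S = - (S * S) := by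
    have : (1 + S) * (1 + S) = 1 + ((2:ℝ) • S + S * S) := by
      rw [two_smul]; noncomm_ring
    rw [this] at hort
    exact eq_neg_of_add_eq_zero_left (by simpa using hort)
  have hn := congrArg norm h2S
  rw [norm_neg, norm_smul] at hn
  have hn2 := norm_mul_le S S
  have hS0 : S = 0 := by
    rw [← norm_eq_zero]
    simp at hn
    nlinarith [norm_nonneg S]
  have : A = f p.1 := by
    apply Subtype.ext
    rw [← hpA]
    simp [← hS, hS0]
  rw [this]; exact h1 _

/-- continuous one-parameter groups are strictly differentiable at zero -/
lemma one_param {A : Type*} [NormedRing A] [NormedAlgebra ℝ A] [CompleteSpace A]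
    (c : ℝ → A) (hc : Continuous c) (h0 : c 0 = 1) (hm : ∀ s t, c (s + t) = c s * c t) :
    ∃ X : A, HasStrictDerivAt c X 0 := by
  have hI : ∀ a b, IntervalIntegrable c MeasureTheory.volume a b :=
    fun a b => hc.intervalIntegrable a b
  let F : ℝ → A := fun u => ∫ x in (0:ℝ)..u, c x
  have hF : ∀ b, HasStrictDerivAt F (c b) b := fun b => hc.integral_hasStrictDerivAt 0 b
  -- the average is invertible for small `a`
  have hlim : Filter.Tendsto (fun a : ℝ => a⁻¹ • F a) (nhdsWithin 0 {0}ᶜ) (nhds 1) := by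
    have h1 := hasDerivAt_iff_tendsto_slope.1 (hF 0).hasDerivAt
    rw [h0] at h1
    refine h1.congr (fun a => ?_)
    rw [slope_def_module]
    simp [F]
  have hun : ∀ᶠ x in nhds (1 : A), IsUnit x := Units.isOpen.mem_nhds (by simp)
  obtain ⟨a, ha, ha0⟩ := ((hlim.eventually hun).and self_mem_nhdsWithin).exists
  have ha0 : a ≠ 0 := ha0
  have hFa : IsUnit (F a) := by
    have := ha.smul (Units.mk0 a ha0)
    simpa [Units.smul_def, smul_smul, ha0] using this
  obtain ⟨u, hu⟩ := hFa
  have key : ∀ s, c s = (F (s + a) - F s) * ((u⁻¹ : Aˣ) : A) := by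
    intro s
    have h1 : F (s + a) - F s = c s * F a := by
      have e1 : F (s + a) - F s = ∫ x in s..(s + a), c x :=
        intervalIntegral.integral_interval_sub_left (hI _ _) (hI _ _)
      have e2 : ∫ x in s..(s + a), c x = ∫ x in (0:ℝ)..a, c (s + x) := by
        rw [intervalIntegral.integral_comp_add_left]; simp
      rw [e1, e2]
      simp only [hm]
      exact (ContinuousLinearMap.mul ℝ A (c s)).intervalIntegral_comp_comm (hI 0 a)
    rw [h1, ← hu, mul_assoc, Units.mul_inv, mul_one]
  refine ⟨(c (0 + a) - c 0) * ((u⁻¹ : Aˣ) : A), ?_⟩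
  have h2 : HasStrictDerivAt (fun s => F (s + a)) (c (0 + a)) 0 :=
    by
      have := (hF (0 + a)).scomp (0:ℝ) ((hasStrictDerivAt_id (0:ℝ)).add_const a)
      rw [one_smul] at this
      exact this
  have h3 := (h2.sub (hF 0)).mul_const ((u⁻¹ : Aˣ) : A)
  have h4 : c = fun s => (F (s + a) - F s) * ((u⁻¹ : Aˣ) : A) := funext key
  have h5 : HasStrictDerivAt (fun s => (F (s + a) - F s) * ((u⁻¹ : Aˣ) : A))
    ((c (0 + a) - c 0) * ((u⁻¹ : Aˣ) : A)) 0 := h3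
  rw [← h4] at h5
  exact h5

/-- if the generator kills a vector, the group fixes it -/
lemma one_param_fix {n : ℕ} (c : ℝ → Mat n) (h0 : c 0 = 1) (hm : ∀ s t, c (s + t) = c s * c t)
    (X : Mat n) (hX : HasStrictDerivAt c X 0) (v : Fin n → ℝ) (hv : X *ᵥ v = 0) (t : ℝ) :
    c t *ᵥ v = v := by
  let ev : Mat n →L[ℝ] (Fin n → ℝ) :=
    LinearMap.toContinuousLinearMap ((Matrix.mulVecBilin ℝ ℝ).flip v)
  have hev : ∀ M, ev M = M *ᵥ v := fun M => rfl
  have hd : ∀ s, HasDerivAt (fun t => ev (c t)) 0 s := by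
    intro s
    have h1 : HasDerivAt (fun t => c (t - s)) X s := by
      have h1' : HasDerivAt c X (s - s) := by rw [sub_self]; exact hX.hasDerivAt
      exact HasDerivAt.comp_sub_const s s h1'
    have h2 : HasDerivAt (fun t => c s * c (t - s)) (c s * X) s := h1.const_mul (c s)
    have h3 : (fun t => c s * c (t - s)) = c := by
      funext t; rw [← hm]; congr 1; ring
    rw [h3] at h2
    have h4 := ev.hasFDerivAt.comp_hasDerivAt s h2
    have h5 : ev (c s * X) = 0 := by
      change (c s * X) *ᵥ v = 0
      rw [← Matrix.mulVec_mulVec, hv, Matrix.mulVec_zero]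
    exact h4.congr_deriv h5
  have := is_const_of_deriv_eq_zero (fun s => (hd s).differentiableAt) (fun s => (hd s).deriv) t 0
  simpa [hev, h0] using this

/-- the key linear algebra step -/
lemma all_of_perm_inv {n : ℕ} (V : Submodule ℝ (Mat n))
    (hsk : ∀ X ∈ V, Xᵀ = -X)
    (hbr : ∀ X ∈ V, ∀ Y ∈ V, X * Y - Y * X ∈ V)
    (hperm : ∀ X ∈ V, ∀ σ : Equiv.Perm (Fin n), X.submatrix σ σ ∈ V)
    (B : Mat n) (hB : B ∈ V) (hB1 : B *ᵥ (fun _ => 1) ≠ 0) (i j : Fin n) :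
    (Matrix.single i j 1 - Matrix.single j i 1 : Mat n) ∈ V := by
  obtain ⟨p, hp⟩ := Function.ne_iff.1 hB1
  have hp : ∑ a, B p a ≠ 0 := by simpa [Matrix.mulVec, dotProduct] using hp
  let T : Fin n → Mat n := fun i => Matrix.of fun a b =>
    (if a = i then 1 else 0) - (if b = i then 1 else 0)
  let S : Finset (Equiv.Perm (Fin n)) := Finset.univ.filter (fun σ => σ p = p)
  let M : Mat n := ∑ σ ∈ S, B.submatrix σ σ
  have hM : M ∈ V := V.sum_mem (fun σ _ => hperm B hB σ)
  have hMs : ∀ a b, M b a = - M a b := by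
    intro a b
    have := congrFun (congrFun (hsk M hM) a) b
    simpa using this
  have hMapp : ∀ a b, M a b = ∑ σ ∈ S, B (σ a) (σ b) := by
    intro a b
    simp [M, Matrix.sum_apply]
  have hinv : ∀ τ : Equiv.Perm (Fin n), τ p = p → ∀ a b, M (τ a) (τ b) = M a b := by
    intro τ hτ a b
    rw [hMapp, hMapp]
    refine Finset.sum_equiv (Equiv.mulRight τ) ?_ ?_
    · intro σ
      simp [S, hτ]
    · intro σ _
      simp
  have hM0 : ∀ a b, a ≠ p → b ≠ p → M a b = 0 := by
    intro a b ha hb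
    have h1 := hinv (Equiv.swap a b) (Equiv.swap_apply_of_ne_of_ne ha.symm hb.symm) a b
    simp at h1
    have h2 := hMs a b
    linarith
  have hMp : ∀ a b, a ≠ p → b ≠ p → M p a = M p b := by
    intro a b ha hb
    have h1 := hinv (Equiv.swap a b) (Equiv.swap_apply_of_ne_of_ne ha.symm hb.symm) p a
    rw [Equiv.swap_apply_of_ne_of_ne ha.symm hb.symm, Equiv.swap_apply_left] at h1
    exact h1.symm
  have hMpp : M p p = 0 := by
    have := hMs p p
    linarith
  have hsum : ∑ a, M p a ≠ 0 := by
    have h1 : ∑ a, M p a = S.card • ∑ a, B p a := by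
      simp_rw [hMapp]
      rw [Finset.sum_comm, ← Finset.sum_const]
      refine Finset.sum_congr rfl (fun σ hσ => ?_)
      have hσ : σ p = p := by simpa [S] using hσ
      rw [hσ]
      exact Equiv.sum_comp σ (fun a => B p a)
    rw [h1]
    have hS : 0 < S.card := Finset.card_pos.2 ⟨1, by simp [S]⟩
    simp only [nsmul_eq_mul]
    exact mul_ne_zero (by exact_mod_cast hS.ne') hp
  obtain ⟨q, -, hq⟩ := Finset.exists_ne_zero_of_sum_ne_zero hsum
  have hqp : q ≠ p := by rintro rfl; exact hq hMpp
  have hTp : T p ∈ V := by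
    have : T p = (M p q)⁻¹ • M := by
      ext a b
      simp only [T, Matrix.of_apply, Matrix.smul_apply, smul_eq_mul]
      by_cases ha : a = p <;> by_cases hb : b = p
      · subst ha; subst hb; simp [hMpp]
      · subst ha
        rw [hMp b q hb hqp]
        simp [hb, hq]
      · subst hb
        rw [hMs b a, hMp a q ha hqp]
        simp [ha, hq]
      · simp [ha, hb, hM0 a b ha hb]
    rw [this]
    exact V.smul_mem _ hM
  have hT : ∀ i, T i ∈ V := by
    intro i
    have h1 := hperm _ hTp (Equiv.swap i p)
    have h2 : (T p).submatrix (Equiv.swap i p) (Equiv.swap i p) = T i := by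
      ext a b
      simp only [T, Matrix.submatrix_apply, Matrix.of_apply]
      have : ∀ a, (Equiv.swap i p a = p) = (a = i) := by
        intro a
        rw [Equiv.swap_apply_eq_iff, Equiv.swap_apply_right]
      simp [this]
    rw [← h2]; exact h1
  by_cases hij : i = j
  · subst hij; simp
  have hn : (n : ℝ) ≠ 0 := by
    have : 0 < n := Fin.pos i
    exact_mod_cast this.ne'
  have hbr' : (Matrix.single i j 1 - Matrix.single j i 1 : Mat n)
      = (n : ℝ)⁻¹ • (T i - T j - (T i * T j - T j * T i)) := by
    have hcomp : T i * T j - T j * T i =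
        T i - T j - (n : ℝ) • (Matrix.single i j 1 - Matrix.single j i 1 : Mat n) := by
      have hij' : ¬ j = i := fun h => hij h.symm
      have hprod : ∀ i j : Fin n, i ≠ j → ∀ a b, (T i * T j) a b =
          (if a = i then 1 else 0) + (if b = j then 1 else 0) -
            n * ((if a = i then 1 else 0) * (if b = j then 1 else 0)) := by
        intro i j hij a b
        simp only [T, Matrix.mul_apply, Matrix.of_apply]
        generalize (if a = i then (1:ℝ) else 0) = x
        generalize (if b = j then (1:ℝ) else 0) = y
        have e : ∀ m : Fin n, (x - if m = i then (1:ℝ) else 0) * ((if m = j then (1:ℝ) else 0) - y)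
            = (if m = j then x else 0) + (if m = i then y else 0) - x * y := by
          intro m
          by_cases h1 : m = i <;> by_cases h2 : m = j
          · exact absurd (h1.symm.trans h2) hij
          all_goals simp [h1, h2, hij, hij.symm]
          all_goals try ring
        simp_rw [e]
        simp [Finset.sum_sub_distrib, Finset.sum_add_distrib]
      ext a b
      rw [Matrix.sub_apply, hprod i j hij, hprod j i hij']
      simp only [T, Matrix.sub_apply, Matrix.of_apply, Matrix.smul_apply, Matrix.single_apply,
        smul_eq_mul]
      by_cases h1 : a = i <;> by_cases h2 : a = j <;> by_cases h3 : b = i <;> by_cases h4 : b = j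
        <;> simp [h1, h2, h3, h4, hij, hij', eq_comm] <;> grind
    rw [hcomp, sub_sub_cancel, smul_smul, inv_mul_cancel₀ hn, one_smul]
  rw [hbr']
  exact V.smul_mem _ (V.sub_mem (V.sub_mem (hT i) (hT j)) (hbr _ (hT i) _ (hT j)))

/-- conjugation by a permutation, on the orthogonal group -/
def permConj {n : ℕ} (σ : Equiv.Perm (Fin n)) :
    Matrix.orthogonalGroup (Fin n) ℝ →* Matrix.orthogonalGroup (Fin n) ℝ where
  toFun A := ⟨A.1.submatrix σ σ, by
    rw [Matrix.mem_orthogonalGroup_iff]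
    change A.1.submatrix σ σ * A.1ᵀ.submatrix σ σ = 1
    rw [Matrix.submatrix_mul_equiv]
    have : A.1 * A.1ᵀ = 1 := (Matrix.mem_orthogonalGroup_iff _ _).1 A.2
    rw [this, Matrix.submatrix_one_equiv]⟩
  map_one' := Subtype.ext (by simp)
  map_mul' A B := Subtype.ext (by
    simp only [Submonoid.coe_mul]
    rw [Matrix.submatrix_mul_equiv])

lemma perm_conj_eq {n : ℕ} (σ : Equiv.Perm (Fin n)) (A : Mat n) :
    (σ.permMatrix ℝ)⁻¹ * A * σ.permMatrix ℝ = A.submatrix σ.symm σ.symm := by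
  have hinv : (σ.permMatrix ℝ)⁻¹ = (σ⁻¹).permMatrix ℝ := by
    apply Matrix.inv_eq_left_inv
    rw [← Matrix.permMatrix_mul]
    simp
  rw [hinv]
  unfold Equiv.Perm.permMatrix
  rw [PEquiv.toMatrix_toPEquiv_mul, PEquiv.mul_toMatrix_toPEquiv]
  rfl

lemma hasStrictDerivAt_submatrix {n : ℕ} {c : ℝ → Mat n} {X : Mat n} {t : ℝ}
    (σ : Equiv.Perm (Fin n)) (h : HasStrictDerivAt c X t) :
    HasStrictDerivAt (fun t => (c t).submatrix σ σ) (X.submatrix σ σ) t := by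
  let T : Mat n →L[ℝ] Mat n :=
    LinearMap.toContinuousLinearMap (Matrix.reindexLinearEquiv ℝ ℝ σ.symm σ.symm).toLinearMap
  exact T.hasStrictFDerivAt.comp_hasStrictDerivAt t h

lemma tanSp_perm {n : ℕ} {H : Subgroup (Matrix.orthogonalGroup (Fin n) ℝ)}
    (σ : Equiv.Perm (Fin n)) (hσ : H ≤ H.comap (permConj σ)) (X : Mat n) (hX : X ∈ tanSp H) :
    X.submatrix σ σ ∈ tanSp H := by
  obtain ⟨c, h1, h2, h3⟩ := hX
  exact ⟨fun t => permConj σ (c t), fun t => hσ (h1 t), by simp [h2],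
    hasStrictDerivAt_submatrix σ h3⟩

lemma exists_gen {k N : ℕ} (hN : 3 ≤ N)
    (φ : SO k →* SO N) (hφcont : Continuous φ)
    (hirr : ¬ ∃ W : Submodule ℝ (Fin N → ℝ), Module.finrank ℝ W = 1 ∧
      ∀ g : SO k,
        W.map (Matrix.mulVecLin ((φ g : Matrix.orthogonalGroup (Fin N) ℝ) :
          Matrix (Fin N) (Fin N) ℝ)) = W)
    (H : Subgroup (Matrix.orthogonalGroup (Fin N) ℝ)) (hH : ∀ g, (φ g).1 ∈ H) :
    ∃ B ∈ tanSp H, B *ᵥ (fun _ => (1:ℝ)) ≠ 0 := by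
  by_contra! hcon
  apply hirr
  let one : Fin N → ℝ := fun _ => 1
  have hone : one ≠ 0 := by
    intro h
    have := congrFun h ⟨0, by omega⟩
    simp [one] at this
  have hfix : ∀ g : SO k, ((φ g).1 : Mat N) *ᵥ one = one := by
    let K0 : Subgroup (SO k) :=
      { carrier := {g | ((φ g).1 : Mat N) *ᵥ one = one}
        mul_mem' := by
          intro a b ha hb
          change ((φ (a * b)).1 : Mat N) *ᵥ one = one
          have ha : ((φ a).1 : Mat N) *ᵥ one = one := ha
          have hb : ((φ b).1 : Mat N) *ᵥ one = one := hb
          rw [map_mul, Subgroup.coe_mul, Submonoid.coe_mul, ← Matrix.mulVec_mulVec, hb, ha]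
        one_mem' := by
          change ((φ 1).1 : Mat N) *ᵥ one = one
          simp
        inv_mem' := by
          intro a ha
          have ha : ((φ a).1 : Mat N) *ᵥ one = one := ha
          change ((φ a⁻¹).1 : Mat N) *ᵥ one = one
          conv_lhs => rw [← ha]
          rw [Matrix.mulVec_mulVec, ← Submonoid.coe_mul, ← Subgroup.coe_mul, ← map_mul,
            inv_mul_cancel]
          simp }
    have hle : SO k ≤ K0.map (SO k).subtype := by
      apply SO_le_of_rot
      intro u w hu hw huw t
      let r : ℝ → SO k := fun t => ⟨⟨rotM u w t, rotM_mem u w hu hw huw t⟩,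
        rotM_det u w hu hw huw t⟩
      have hr : Continuous r :=
        ((rotM_continuous u w).subtype_mk _).subtype_mk _
      have hr0 : r 0 = 1 := Subtype.ext (Subtype.ext (rotM_zero u w))
      have hrm : ∀ s t, r (s + t) = r s * r t := fun s t =>
        Subtype.ext (Subtype.ext (rotM_mul u w hu hw huw s t).symm)
      let c : ℝ → Mat N := fun t => ((φ (r t)).1 : Mat N)
      have hc : Continuous c :=
        continuous_subtype_val.comp (continuous_subtype_val.comp (hφcont.comp hr))
      have hc0 : c 0 = 1 := by simp [c, hr0]
      have hcm : ∀ s t, c (s + t) = c s * c t := by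
        intro s t
        simp [c, hrm]
      obtain ⟨X, hX⟩ := one_param c hc hc0 hcm
      have hXt : X ∈ tanSp H := ⟨fun t => (φ (r t)).1, fun t => hH _, by simp [hr0], hX⟩
      refine ⟨r t, ?_, rfl⟩
      exact one_param_fix c hc0 hcm X hX one (hcon X hXt) t
    intro g
    obtain ⟨g', hg', he⟩ := hle g.2
    have : g' = g := Subtype.ext he
    rw [← this]; exact hg'
  refine ⟨Submodule.span ℝ {one}, finrank_span_singleton hone, fun g => ?_⟩
  rw [Submodule.map_span, Set.image_singleton, Matrix.mulVecLin_apply, hfix g]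

end helpers

theorem statement1 (k N : ℕ) (hk : 3 ≤ k) (hN : 3 ≤ N)
    (φ : SO k →* SO N) (hφcont : Continuous φ)
    (hirr : ¬ ∃ W : Submodule ℝ (Fin N → ℝ), Module.finrank ℝ W = 1 ∧
      ∀ g : SO k,
        W.map (Matrix.mulVecLin ((φ g : Matrix.orthogonalGroup (Fin N) ℝ) :
          Matrix (Fin N) (Fin N) ℝ)) = W)
    (σ₀ : Equiv.Perm (Fin N)) (hσ₀ : Equiv.Perm.sign σ₀ = -1) :
    Subgroup.closure
      ({x : Matrix.orthogonalGroup (Fin N) ℝ |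
          (x : Matrix (Fin N) (Fin N) ℝ) = σ₀.permMatrix ℝ} ∪
        {x : Matrix.orthogonalGroup (Fin N) ℝ |
          ∃ (g : SO k) (σ : Equiv.Perm (Fin N)),
            (x : Matrix (Fin N) (Fin N) ℝ) =
              (σ.permMatrix ℝ)⁻¹ *
                ((φ g : Matrix.orthogonalGroup (Fin N) ℝ) : Matrix (Fin N) (Fin N) ℝ) *
                σ.permMatrix ℝ}) = ⊤ := by
  classical
  set s1 : Set (Matrix.orthogonalGroup (Fin N) ℝ) := {x : Matrix.orthogonalGroup (Fin N) ℝ |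
          (x : Matrix (Fin N) (Fin N) ℝ) = σ₀.permMatrix ℝ} with hs1
  set s2 : Set (Matrix.orthogonalGroup (Fin N) ℝ) := {x : Matrix.orthogonalGroup (Fin N) ℝ |
          ∃ (g : SO k) (σ : Equiv.Perm (Fin N)),
            (x : Matrix (Fin N) (Fin N) ℝ) =
              (σ.permMatrix ℝ)⁻¹ *
                ((φ g : Matrix.orthogonalGroup (Fin N) ℝ) : Matrix (Fin N) (Fin N) ℝ) *
                σ.permMatrix ℝ} with hs2
  have hmem2 : ∀ x, x ∈ s2 ↔ ∃ (g : SO k) (σ : Equiv.Perm (Fin N)),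
      (x : Mat N) = ((φ g).1 : Mat N).submatrix σ σ := by
    intro x
    constructor
    · rintro ⟨g, σ, h⟩
      exact ⟨g, σ.symm, by rw [h, perm_conj_eq]⟩
    · rintro ⟨g, σ, h⟩
      exact ⟨g, σ.symm, by rw [h, perm_conj_eq, Equiv.symm_symm]⟩
  let H := Subgroup.closure s2
  have hconj : ∀ σ : Equiv.Perm (Fin N), H ≤ H.comap (permConj σ) := by
    intro σ
    refine (Subgroup.closure_le _).2 ?_
    intro x hx
    obtain ⟨g, τ, h⟩ := (hmem2 x).1 hx
    refine Subgroup.subset_closure ((hmem2 _).2 ⟨g, σ.trans τ, ?_⟩)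
    change (x : Mat N).submatrix σ σ = _
    rw [h]
    rfl
  have hφH : ∀ g, (φ g).1 ∈ H := fun g =>
    Subgroup.subset_closure ((hmem2 _).2 ⟨g, Equiv.refl _, by simp⟩)
  obtain ⟨B, hB, hB1⟩ := exists_gen hN φ hφcont hirr H hφH
  have hSO : SO N ≤ H := nhds_of_tan H (fun i j =>
    all_of_perm_inv (tanSp H) (fun X hX => IsTan.skew hX) (fun X hX Y hY => tanSp_bracket hX hY)
      (fun X hX σ => tanSp_perm σ (hconj σ) X hX) B hB hB1 i j)
  have hSO2 : SO N ≤ Subgroup.closure (s1 ∪ s2) :=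
    hSO.trans (Subgroup.closure_mono Set.subset_union_right)
  rw [Subgroup.eq_top_iff']
  intro A
  have hP : (1 : Mat N).submatrix σ₀ id ∈ Matrix.orthogonalGroup (Fin N) ℝ := by
    rw [Matrix.mem_orthogonalGroup_iff]
    change (1 : Mat N).submatrix σ₀ (Equiv.refl _) *
      ((1 : Mat N).submatrix σ₀ (Equiv.refl _))ᵀ = 1
    rw [Matrix.transpose_submatrix, Matrix.submatrix_mul_equiv]
    simp
  have hPe : (1 : Mat N).submatrix σ₀ id = σ₀.permMatrix ℝ := by
    rw [Equiv.Perm.permMatrix, ← Matrix.mul_one (PEquiv.toMatrix _), PEquiv.toMatrix_toPEquiv_mul]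
  let P : Matrix.orthogonalGroup (Fin N) ℝ := ⟨_, hP⟩
  have hPm : P ∈ Subgroup.closure (s1 ∪ s2) := Subgroup.subset_closure (Or.inl hPe)
  have hPd : (P : Mat N).det = -1 := by
    change ((1 : Mat N).submatrix σ₀ id).det = -1
    rw [hPe, Matrix.det_permutation, hσ₀]
    simp
  have hAd : (A : Mat N).det * (A : Mat N).det = 1 := by
    have h2 : (A : Mat N) * (A : Mat N)ᵀ = 1 := (Matrix.mem_orthogonalGroup_iff _ _).1 A.2
    have h3 := congrArg Matrix.det h2
    rwa [det_mul, det_transpose, det_one] at h3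
  rcases mul_self_eq_one_iff.1 hAd with h | h
  · exact hSO2 h
  · have h1 : A * P ∈ SO N := by
      change ((A * P : Matrix.orthogonalGroup (Fin N) ℝ) : Mat N).det = 1
      rw [Submonoid.coe_mul, det_mul, h, hPd]
      norm_num
    have := Subgroup.mul_mem _ (hSO2 h1) (Subgroup.inv_mem _ hPm)
    simpa using this
end

section
/- Let d ≥ 3 and let X = (X₁,…,X_d) be an ℝ^d-valued random vector. Suppose there exist k ≥ 3 and a continuous group homomorphism φ : SO(k) → SO(d) acting irreducibly on ℝ^d such that φ(g)X has the same law as X for every g ∈ SO(k), and suppose the family {X₁,…,X_d} is exchangeable. Then the law of X is invariant under the full group SO(d), i.e. OX has the same law as X for every O ∈ SO(d). -/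
open Matrix MeasureTheory

/-- The matrix of an element of `SO(n)`. -/
def SOmat {n : ℕ} (g : SO n) : Matrix (Fin n) (Fin n) ℝ :=
  ((g : Matrix.orthogonalGroup (Fin n) ℝ) : Matrix (Fin n) (Fin n) ℝ)

/-- elementary bivector -/
def biv {d : ℕ} (i j : Fin d) : Matrix (Fin d) (Fin d) ℝ :=
  Matrix.of fun p q => (if p = i then 1 else 0) * (if q = j then 1 else 0) -
    (if p = j then 1 else 0) * (if q = i then 1 else 0)

def cyc {d : ℕ} (i j k : Fin d) : Matrix (Fin d) (Fin d) ℝ := biv i j + biv j k + biv k i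

lemma biv_self {d : ℕ} (i : Fin d) : biv i i = 0 := by
  ext p q; simp [biv]

lemma biv_swap {d : ℕ} (i j : Fin d) : biv j i = - biv i j := by
  ext p q; simp [biv]

lemma biv_submatrix {d : ℕ} (i j : Fin d) (σ : Equiv.Perm (Fin d)) :
    (biv (σ i) (σ j)).submatrix σ σ = biv i j := by
  ext p q; simp [biv]

lemma skew_eq_sum {d : ℕ} (A : Matrix (Fin d) (Fin d) ℝ) (hA : Aᵀ = -A) :
    A = ∑ i, ∑ j, (A i j / 2) • biv i j := by
  ext p q
  have h : A q p = - A p q := by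
    have := congrFun (congrFun hA p) q
    simpa using this
  simp only [Matrix.sum_apply, Matrix.smul_apply, biv, Matrix.of_apply, smul_eq_mul, mul_sub,
    Finset.sum_sub_distrib]
  simp [h]
  ring

lemma skew_apply {d : ℕ} {A : Matrix (Fin d) (Fin d) ℝ} (hA : Aᵀ = -A) (p q : Fin d) :
    A q p = - A p q := by
  have := congrFun (congrFun hA p) q
  simpa using this

lemma signed_sum {d : ℕ} (A : Matrix (Fin d) (Fin d) ℝ) (hA : Aᵀ = -A) (i j k : Fin d)
    (hij : i ≠ j) (hjk : j ≠ k) (hik : i ≠ k) :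
    A - A.submatrix (Equiv.swap i j) (Equiv.swap i j)
      - A.submatrix (Equiv.swap j k) (Equiv.swap j k)
      - A.submatrix (Equiv.swap i k) (Equiv.swap i k)
      + A.submatrix (Equiv.swap i j * Equiv.swap j k : Equiv.Perm (Fin d))
          (Equiv.swap i j * Equiv.swap j k : Equiv.Perm (Fin d))
      + A.submatrix (Equiv.swap j k * Equiv.swap i j : Equiv.Perm (Fin d))
          (Equiv.swap j k * Equiv.swap i j : Equiv.Perm (Fin d))
      = (2 * (A i j + A j k + A k i)) • cyc i j k := by
  have hs := fun p q => skew_apply hA p q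
  have h0 : ∀ p, A p p = 0 := fun p => by linarith [hs p p]
  ext p q
  have hp : p = i ∨ p = j ∨ p = k ∨ (p ≠ i ∧ p ≠ j ∧ p ≠ k) := by tauto
  have hq : q = i ∨ q = j ∨ q = k ∨ (q ≠ i ∧ q ≠ j ∧ q ≠ k) := by tauto
  have hij' := hij.symm
  have hjk' := hjk.symm
  have hik' := hik.symm
  rcases hp with rfl | rfl | rfl | ⟨hp1, hp2, hp3⟩ <;>
  rcases hq with rfl | rfl | rfl | ⟨hq1, hq2, hq3⟩ <;>
  simp only [Matrix.sub_apply, Matrix.add_apply, Matrix.submatrix_apply, Matrix.smul_apply,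
    Equiv.Perm.mul_apply, cyc, biv, Equiv.swap_apply_def, Matrix.of_apply, if_true, if_false,
    h0, smul_eq_mul] <;>
  grind

lemma exists_perm3 {d : ℕ} {i j k p q r : Fin d} (hij : i ≠ j) (hjk : j ≠ k) (hik : i ≠ k)
    (hpq : p ≠ q) (hqr : q ≠ r) (hpr : p ≠ r) :
    ∃ σ : Equiv.Perm (Fin d), σ i = p ∧ σ j = q ∧ σ k = r := by
  refine ⟨Equiv.swap i p |>.trans (Equiv.swap (Equiv.swap i p j) q) |>.trans
    (Equiv.swap (Equiv.swap (Equiv.swap i p j) q (Equiv.swap i p k)) r), ?_, ?_, ?_⟩ <;>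
  grind

lemma span_all {d : ℕ} (hd : 3 ≤ d) (W : Submodule ℝ (Matrix (Fin d) (Fin d) ℝ))
    (hskew : ∀ A ∈ W, Aᵀ = -A)
    (hperm : ∀ σ : Equiv.Perm (Fin d), ∀ A ∈ W, A.submatrix σ σ ∈ W)
    (h1 : ∃ A ∈ W, ∃ i j k, A i j + A j k + A k i ≠ 0)
    (h2 : ∃ A ∈ W, ∃ i, ∑ j, A i j ≠ 0) :
    ∀ B : Matrix (Fin d) (Fin d) ℝ, Bᵀ = -B → B ∈ W := by
  have hdR : (d : ℝ) ≠ 0 := by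
    have : d ≠ 0 := by omega
    exact_mod_cast this
  -- all cyclic elements
  have hc : ∀ i j k : Fin d, cyc i j k ∈ W := by
    obtain ⟨A, hA, i, j, k, hne⟩ := h1
    have hs := fun p q => skew_apply (hskew A hA) p q
    have h0 : ∀ p, A p p = 0 := fun p => by linarith [hs p p]
    have hij : i ≠ j := by
      rintro rfl; apply hne; rw [h0, hs i k]; ring
    have hjk : j ≠ k := by
      rintro rfl; apply hne; rw [h0, hs i j]; ring
    have hik : i ≠ k := by
      rintro rfl; apply hne; rw [h0, hs i j]; ring
    have key : cyc i j k ∈ W := by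
      have hm : (2 * (A i j + A j k + A k i)) • cyc i j k ∈ W := by
        rw [← signed_sum A (hskew A hA) i j k hij hjk hik]
        refine W.add_mem (W.add_mem (W.sub_mem (W.sub_mem (W.sub_mem hA ?_) ?_) ?_) ?_) ?_ <;>
        exact hperm _ _ hA
      exact (W.smul_mem_iff (mul_ne_zero two_ne_zero hne)).1 hm
    intro p q r
    by_cases hpq : p = q
    · subst hpq; simp only [cyc, biv_self, biv_swap p r]; simp
    by_cases hqr : q = r
    · subst hqr; simp only [cyc, biv_self, biv_swap p q]; simp
    by_cases hpr : p = r
    · subst hpr; simp only [cyc, biv_self, biv_swap p q]; simp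
    obtain ⟨σ, rfl, rfl, rfl⟩ := exists_perm3 hpq hqr hpr hij hjk hik
    have := hperm σ _ key
    simpa [cyc, Matrix.submatrix_add, biv_submatrix] using this
  set S : Fin d → Matrix (Fin d) (Fin d) ℝ := fun i => ∑ k, biv i k with hS
  have hcs : ∀ i j, (d : ℝ) • biv i j - (S i - S j) ∈ W := by
    intro i j
    have : (d : ℝ) • biv i j - (S i - S j) = ∑ k, cyc i j k := by
      simp only [cyc, Finset.sum_add_distrib, hS, fun k => biv_swap i k, Finset.sum_neg_distrib]
      simp [Nat.cast_smul_eq_nsmul]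
      abel
    rw [this]
    exact W.sum_mem fun k _ => hc i j k
  have hSe : ∀ i p q, S i p q = (if p = i then 1 else 0) - (if q = i then 1 else 0) := by
    intro i p q
    simp [hS, Matrix.sum_apply, biv]
  have hSS : ∀ p q, S p - S q ∈ W := by
    obtain ⟨A, hA, i₀, hr⟩ := h2
    set r : Fin d → ℝ := fun i => ∑ j, A i j with hrdef
    have hs := fun p q => skew_apply (hskew A hA) p q
    have hR : (∑ i, r i • S i) ∈ W := by
      have e1 : (d : ℝ) • A - ∑ i, r i • S i =
          ∑ i, ∑ j, (A i j / 2) • ((d : ℝ) • biv i j - (S i - S j)) := by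
        have e2 : ∑ i, ∑ j, (A i j / 2) • S i = ∑ i, (r i / 2) • S i := by
          refine Finset.sum_congr rfl fun i _ => ?_
          rw [← Finset.sum_smul, hrdef, Finset.sum_div]
        have e3 : ∑ i, ∑ j, (A i j / 2) • S j = - ∑ i, (r i / 2) • S i := by
          rw [Finset.sum_comm, ← Finset.sum_neg_distrib]
          refine Finset.sum_congr rfl fun i _ => ?_
          rw [← Finset.sum_smul, ← neg_smul, hrdef, Finset.sum_div, ← Finset.sum_neg_distrib]
          congr 1
          refine Finset.sum_congr rfl fun j _ => ?_
          rw [hs i j]; ring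
        simp only [smul_sub, Finset.sum_sub_distrib, e2, e3]
        conv_lhs => rw [skew_eq_sum A (hskew A hA)]
        rw [Finset.smul_sum]
        congr 1
        · refine Finset.sum_congr rfl fun i _ => ?_
          rw [Finset.smul_sum]
          refine Finset.sum_congr rfl fun j _ => ?_
          rw [smul_comm]
        · rw [sub_neg_eq_add, ← Finset.sum_add_distrib]
          refine Finset.sum_congr rfl fun i _ => ?_
          rw [← add_smul]; congr 1; ring
      have e4 : (d : ℝ) • A - ∑ i, r i • S i ∈ W := by
        rw [e1]
        exact W.sum_mem fun i _ => W.sum_mem fun j _ => W.smul_mem _ (hcs i j)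
      have := W.sub_mem (W.smul_mem (d : ℝ) hA) e4
      simpa using this
    have hRe : ∀ p q, (∑ i, r i • S i) p q = r p - r q := by
      intro p q
      simp [Matrix.sum_apply, hSe, mul_sub]
    have hsum : ∑ i, r i = 0 := by
      have : ∑ i, r i = - ∑ i, r i := by
        refine (Finset.sum_comm (f := fun i j => A i j)).trans ?_
        rw [← Finset.sum_neg_distrib]
        refine Finset.sum_congr rfl fun j _ => ?_
        change _ = - ∑ i, A j i
        rw [← Finset.sum_neg_distrib]
        exact Finset.sum_congr rfl fun i _ => hs j i
      linarith
    obtain ⟨j₀, hj⟩ : ∃ j, r i₀ ≠ r j := by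
      by_contra! hcon
      have : ∑ j, r j = ∑ j : Fin d, r i₀ := Finset.sum_congr rfl fun j _ => (hcon j).symm
      rw [hsum] at this
      rw [Finset.sum_const, Finset.card_univ, Fintype.card_fin, nsmul_eq_mul] at this
      exact hr ((mul_eq_zero.1 this.symm).resolve_left hdR)
    have hij : i₀ ≠ j₀ := fun h => hj (by rw [h])
    have hbase : S i₀ - S j₀ ∈ W := by
      have hm := W.sub_mem hR (hperm (Equiv.swap i₀ j₀) _ hR)
      have e : (∑ i, r i • S i) - (∑ i, r i • S i).submatrix (Equiv.swap i₀ j₀)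
          (Equiv.swap i₀ j₀) = (r i₀ - r j₀) • (S i₀ - S j₀) := by
        ext p q
        simp only [Matrix.sub_apply, Matrix.submatrix_apply, hRe, Matrix.smul_apply, hSe,
          smul_eq_mul]
        have : ∀ p, r p - r (Equiv.swap i₀ j₀ p) =
            (r i₀ - r j₀) * ((if p = i₀ then 1 else 0) - (if p = j₀ then 1 else 0)) := by
          intro p
          rw [Equiv.swap_apply_def]
          grind
        linear_combination this p - this q
      rw [e] at hm
      exact (W.smul_mem_iff (sub_ne_zero.2 hj)).1 hm
    intro p q
    by_cases hpq : p = q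
    · subst hpq; simp
    obtain ⟨σ, hσ1, hσ2⟩ : ∃ σ : Equiv.Perm (Fin d), σ p = i₀ ∧ σ q = j₀ := by
      refine ⟨(Equiv.swap p i₀).trans (Equiv.swap (Equiv.swap p i₀ q) j₀), ?_, ?_⟩ <;>
      grind
    have := hperm σ _ hbase
    convert this using 1
    ext a b
    simp [hSe, ← hσ1, ← hσ2]
  have hb : ∀ i j, biv i j ∈ W := by
    intro i j
    have := W.add_mem (hcs i j) (hSS i j)
    rw [sub_add_cancel] at this
    exact (W.smul_mem_iff hdR).1 this
  intro B hB
  rw [skew_eq_sum B hB]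
  exact W.sum_mem fun i _ => W.sum_mem fun j _ => W.smul_mem _ (hb i j)

lemma common_kernel {d : ℕ} (hd : 3 ≤ d) (T : Set (Matrix (Fin d) (Fin d) ℝ))
    (hTo : ∀ Q ∈ T, Q * Qᵀ = 1) (hTt : ∀ Q ∈ T, Qᵀ ∈ T)
    (hirr : ∀ U : Submodule ℝ (Fin d → ℝ),
        (∀ Q ∈ T, U.map (Matrix.mulVecLin Q) = U) → U = ⊥ ∨ U = ⊤)
    (S : Set (Matrix (Fin d) (Fin d) ℝ))
    (hS : ∀ Q ∈ T, ∀ B ∈ S, Q * B * Qᵀ ∈ S)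
    (h1 : ∀ B ∈ S, B *ᵥ 1 = 0) : ∀ B ∈ S, B = 0 := by
  let U : Submodule ℝ (Fin d → ℝ) :=
    { carrier := {x | ∀ B ∈ S, B *ᵥ x = 0}
      add_mem' := by
        intro a b ha hb B hB
        rw [Matrix.mulVec_add, ha B hB, hb B hB, add_zero]
      zero_mem' := by
        intro B _
        exact Matrix.mulVec_zero B
      smul_mem' := by
        intro c x hx B hB
        rw [Matrix.mulVec_smul, hx B hB, smul_zero] }
  have hle : ∀ Q ∈ T, ∀ x ∈ U, Q *ᵥ x ∈ U := by
    intro Q hQ x hx B hB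
    have h := hx _ (hS _ (hTt Q hQ) B hB)
    rw [Matrix.transpose_transpose] at h
    have e : B *ᵥ (Q *ᵥ x) = Q *ᵥ ((Qᵀ * B * Q) *ᵥ x) := by
      rw [Matrix.mulVec_mulVec, Matrix.mulVec_mulVec, ← Matrix.mul_assoc, ← Matrix.mul_assoc,
        hTo Q hQ, Matrix.one_mul]
    rw [e, h, Matrix.mulVec_zero]
  have hmap : ∀ Q ∈ T, U.map (Matrix.mulVecLin Q) = U := by
    intro Q hQ
    apply le_antisymm
    · rintro _ ⟨x, hx, rfl⟩
      exact hle Q hQ x hx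
    · intro x hx
      refine ⟨Qᵀ *ᵥ x, hle _ (hTt Q hQ) x hx, ?_⟩
      simp [Matrix.mulVec_mulVec, hTo Q hQ]
  rcases hirr U hmap with h | h
  · exfalso
    have : (1 : Fin d → ℝ) ∈ U := fun B hB => h1 B hB
    rw [h, Submodule.mem_bot] at this
    have := congrFun this ⟨0, by omega⟩
    simp at this
  · intro B hB
    ext i j
    have : (Pi.single j 1 : Fin d → ℝ) ∈ U := by rw [h]; trivial
    have := congrFun (this B hB) i
    simpa using this

lemma irr_cases {d : ℕ} (hd : 3 ≤ d) (T : Set (Matrix (Fin d) (Fin d) ℝ))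
    (hTo : ∀ Q ∈ T, Q * Qᵀ = 1) (hTt : ∀ Q ∈ T, Qᵀ ∈ T)
    (hirr : ∀ U : Submodule ℝ (Fin d → ℝ),
        (∀ Q ∈ T, U.map (Matrix.mulVecLin Q) = U) → U = ⊥ ∨ U = ⊤)
    (W : Submodule ℝ (Matrix (Fin d) (Fin d) ℝ))
    (hskew : ∀ A ∈ W, Aᵀ = -A)
    (hperm : ∀ σ : Equiv.Perm (Fin d), ∀ A ∈ W, A.submatrix σ σ ∈ W)
    (hconj : ∀ Q ∈ T, ∀ A ∈ W, Q * A * Qᵀ ∈ W)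
    (hne : ∃ A ∈ W, A ≠ 0) :
    (∃ A ∈ W, ∃ i j k, A i j + A j k + A k i ≠ 0) ∧ (∃ A ∈ W, ∃ i, ∑ j, A i j ≠ 0) := by
  have hdR : (d : ℝ) ≠ 0 := by
    have : d ≠ 0 := by omega
    exact_mod_cast this
  have h2 : ∃ A ∈ W, ∃ i, ∑ j, A i j ≠ 0 := by
    by_contra! hcon
    obtain ⟨A, hA, hA0⟩ := hne
    refine hA0 (common_kernel hd T hTo hTt hirr W hconj ?_ A hA)
    intro B hB
    ext i
    simpa [Matrix.mulVec, dotProduct] using hcon B hB i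
  refine ⟨?_, h2⟩
  by_contra! hcon
  have hform : ∀ A ∈ W, ∀ i j, A i j = ((∑ l, A i l) - (∑ l, A j l)) / d := by
    intro A hA i j
    have h : ∑ l : Fin d, (A i j + A j l + A l i) = 0 :=
      Finset.sum_eq_zero fun l _ => hcon A hA i j l
    have h' : ∑ l, A l i = - ∑ l, A i l := by
      rw [← Finset.sum_neg_distrib]
      exact Finset.sum_congr rfl fun l _ => skew_apply (hskew A hA) i l
    rw [Finset.sum_add_distrib, Finset.sum_add_distrib, h', Finset.sum_const, Finset.card_univ,
      Fintype.card_fin, nsmul_eq_mul] at h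
    field_simp
    linarith
  have hsum : ∀ A ∈ W, ∑ i, ∑ j, A i j = 0 := by
    intro A hA
    have : ∑ i, ∑ j, A i j = - ∑ i, ∑ j, A i j := by
      refine (Finset.sum_comm (f := fun i j => A i j)).trans ?_
      rw [← Finset.sum_neg_distrib]
      refine Finset.sum_congr rfl fun j _ => ?_
      rw [← Finset.sum_neg_distrib]
      exact Finset.sum_congr rfl fun i _ => skew_apply (hskew A hA) j i
    linarith
  have hmul : ∀ A ∈ W, ∀ B ∈ W, ∀ p q, (A * B) p q =
      (- d * (∑ l, A p l) * (∑ l, B q l) - ∑ l, (∑ m, A l m) * (∑ m, B l m)) / d ^ 2 := by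
    intro A hA B hB p q
    have e : (A * B) p q = ∑ l, (((∑ m, A p m) * (∑ m, B l m) - (∑ m, A p m) * (∑ m, B q m)
        - (∑ m, A l m) * (∑ m, B l m) + (∑ m, A l m) * (∑ m, B q m))) / (d : ℝ) ^ 2 := by
      rw [Matrix.mul_apply]
      refine Finset.sum_congr rfl fun l _ => ?_
      rw [hform A hA p l, hform B hB l q]
      field_simp
      ring
    rw [e, ← Finset.sum_div]
    congr 1
    rw [Finset.sum_add_distrib, Finset.sum_sub_distrib, Finset.sum_sub_distrib,
      ← Finset.mul_sum, hsum B hB, Finset.sum_const, ← Finset.sum_mul, hsum A hA,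
      Finset.card_univ, Fintype.card_fin, nsmul_eq_mul]
    ring
  have hcomm : ∀ A ∈ W, ∀ B ∈ W, A * B - B * A = 0 := by
    intro A hA B hB
    refine common_kernel hd T hTo hTt hirr {C | ∃ A ∈ W, ∃ B ∈ W, C = A * B - B * A} ?_ ?_ _
      ⟨A, hA, B, hB, rfl⟩
    · rintro Q hQ _ ⟨A, hA, B, hB, rfl⟩
      refine ⟨_, hconj Q hQ A hA, _, hconj Q hQ B hB, ?_⟩
      have hQ' : Qᵀ * Q = 1 := by
        have := hTo _ (hTt Q hQ)
        simpa using this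
      have e : ∀ A B : Matrix (Fin d) (Fin d) ℝ,
          Q * A * Qᵀ * (Q * B * Qᵀ) = Q * (A * B) * Qᵀ := by
        intro A B
        calc Q * A * Qᵀ * (Q * B * Qᵀ) = Q * A * (Qᵀ * Q) * B * Qᵀ := by noncomm_ring
          _ = _ := by rw [hQ']; noncomm_ring
      rw [e, e]; noncomm_ring
    · rintro _ ⟨A, hA, B, hB, rfl⟩
      ext i
      simp only [Matrix.mulVec, dotProduct, Matrix.sub_apply, Pi.one_apply, mul_one,
        Pi.zero_apply]
      simp only [hmul A hA B hB, hmul B hB A hA]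
      rw [Finset.sum_sub_distrib, ← Finset.sum_div, ← Finset.sum_div, Finset.sum_sub_distrib,
        Finset.sum_sub_distrib, ← Finset.mul_sum, ← Finset.mul_sum, hsum A hA, hsum B hB]
      simp only [mul_comm (∑ m, A _ m)]
      ring
  obtain ⟨A, hA, i, hi⟩ := h2
  set r : Fin d → ℝ := fun i => ∑ j, A i j with hr
  have hpar : ∀ σ : Equiv.Perm (Fin d), ∀ p q, r p * r (σ q) = r (σ p) * r q := by
    intro σ p q
    have hB := hperm σ A hA
    have hBr : ∀ l, ∑ m, A.submatrix σ σ l m = r (σ l) := by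
      intro l
      simp only [Matrix.submatrix_apply, hr]
      exact Equiv.sum_comp σ (fun m => A (σ l) m)
    have h := congrFun (congrFun (hcomm A hA _ hB) p) q
    rw [Matrix.sub_apply, hmul A hA _ hB, hmul _ hB A hA] at h
    simp only [hBr] at h
    change (- d * r p * r (σ q) - ∑ l, r l * r (σ l)) / (d : ℝ) ^ 2 -
      (- d * r (σ p) * r q - ∑ l, r (σ l) * r l) / (d : ℝ) ^ 2 = 0 at h
    have e : ∑ l, r (σ l) * r l = ∑ l, r l * r (σ l) :=
      Finset.sum_congr rfl fun l _ => mul_comm _ _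
    rw [e] at h
    field_simp at h
    have : (d : ℝ) * (r p * r (σ q) - r (σ p) * r q) = 0 := by linarith
    have := (mul_eq_zero.1 this).resolve_left hdR
    linarith
  have hi' : r i ≠ 0 := hi
  have hall : ∀ j, r j = r i := by
    intro j
    by_cases hij : j = i
    · rw [hij]
    obtain ⟨k, hk⟩ : ∃ k : Fin d, k ∉ ({i, j} : Finset (Fin d)) := by
      by_contra! hcon
      have : (Finset.univ : Finset (Fin d)) ⊆ {i, j} := fun x _ => hcon x
      have := Finset.card_le_card this
      rw [Finset.card_univ, Fintype.card_fin] at this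
      have := this.trans Finset.card_le_two
      omega
    simp at hk
    have hk1 := hpar (Equiv.swap i k) i k
    have hk2 := hpar (Equiv.swap i j) i k
    rw [Equiv.swap_apply_left, Equiv.swap_apply_right] at hk1
    rw [Equiv.swap_apply_left, Equiv.swap_apply_of_ne_of_ne hk.1 hk.2] at hk2
    have hk0 : r k ≠ 0 := by
      intro h; rw [h] at hk1; simp at hk1; exact hi' hk1
    exact (mul_right_cancel₀ hk0 hk2).symm
  have h := hsum A hA
  change ∑ i, r i = 0 at h
  rw [Finset.sum_congr rfl fun j _ => hall j, Finset.sum_const, Finset.card_univ,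
      Fintype.card_fin, nsmul_eq_mul] at h
  exact (mul_ne_zero hdR hi') h

open scoped Matrix.Norms.L2Operator Topology in
lemma pow_diff_le {d : ℕ} (a b : Matrix (Fin d) (Fin d) ℝ) (ha : ‖a‖ ≤ 1) (hb : ‖b‖ ≤ 1) (m : ℕ) :
    ‖a ^ m - b ^ m‖ ≤ m * ‖a - b‖ := by
  induction m with
  | zero => simp
  | succ m ih =>
    have e : a ^ (m + 1) - b ^ (m + 1) = a * (a ^ m - b ^ m) + (a - b) * b ^ m := by
      rw [pow_succ', pow_succ']; noncomm_ring
    have hbm : ‖(a - b) * b ^ m‖ ≤ ‖a - b‖ := by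
      rcases Nat.eq_zero_or_pos m with rfl | hm
      · simp
      · calc _ ≤ ‖a - b‖ * ‖b ^ m‖ := norm_mul_le _ _
          _ ≤ ‖a - b‖ * 1 := by
            gcongr
            exact (norm_pow_le' b hm).trans (pow_le_one₀ (norm_nonneg _) hb)
          _ = _ := mul_one _
    rw [e]
    calc _ ≤ ‖a * (a ^ m - b ^ m)‖ + ‖(a - b) * b ^ m‖ := norm_add_le _ _
      _ ≤ ‖a‖ * ‖a ^ m - b ^ m‖ + ‖a - b‖ := by gcongr; exact norm_mul_le _ _
      _ ≤ 1 * (m * ‖a - b‖) + ‖a - b‖ := by gcongr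
      _ = _ := by push_cast; ring

open scoped Matrix.Norms.L2Operator Topology in
lemma norm_orth_le {d : ℕ} (hd : 3 ≤ d) (a : Matrix (Fin d) (Fin d) ℝ) (ha : a * aᵀ = 1) :
    ‖a‖ ≤ 1 := by
  have h : a ∈ unitary (Matrix (Fin d) (Fin d) ℝ) := by
    rw [Unitary.mem_iff]
    have : star a = aᵀ := by
      rw [Matrix.star_eq_conjTranspose]; ext; simp
    rw [this]
    exact ⟨mul_eq_one_comm.1 ha, ha⟩
  have : Nonempty (Fin d) := ⟨⟨0, by omega⟩⟩
  exact (CStarRing.norm_of_mem_unitary h).le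

lemma exp_skew {d : ℕ} (A : Matrix (Fin d) (Fin d) ℝ) (hA : Aᵀ = -A) :
    NormedSpace.exp A * (NormedSpace.exp A)ᵀ = 1 := by
  rw [← Matrix.exp_transpose, hA, ← Matrix.exp_add_of_commute _ _ (Commute.neg_right (Commute.refl A))]
  simp

open scoped Matrix.Norms.L2Operator Topology in
lemma exp_deriv_zero {d : ℕ} (A : Matrix (Fin d) (Fin d) ℝ) :
    HasDerivAt (fun t : ℝ => NormedSpace.exp (t • A)) A 0 := by
  have := hasDerivAt_exp_smul_const (𝕂 := ℝ) A (0:ℝ)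
  simpa using this

open scoped Topology in
open Filter in
/-- the key limit lemma -/
lemma limit_lemma {d : ℕ} (hd : 3 ≤ d) (Γ : Set (Matrix (Fin d) (Fin d) ℝ))
    (horth : ∀ a ∈ Γ, a * aᵀ = 1)
    (hone : 1 ∈ Γ) (hmul : ∀ a ∈ Γ, ∀ b ∈ Γ, a * b ∈ Γ) (htr : ∀ a ∈ Γ, aᵀ ∈ Γ)
    (hlim : ∀ (u : ℕ → Matrix (Fin d) (Fin d) ℝ) a, (∀ n, u n ∈ Γ) → Tendsto u atTop (𝓝 a) → a ∈ Γ)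
    (g : ℕ → Matrix (Fin d) (Fin d) ℝ) (t : ℕ → ℝ) (A : Matrix (Fin d) (Fin d) ℝ)
    (hg : ∀ n, g n ∈ Γ) (ht : ∀ n, 0 < t n) (ht0 : Tendsto t atTop (𝓝 0))
    (hA : Tendsto (fun n => (t n)⁻¹ • (g n - 1)) atTop (𝓝 A)) :
    Aᵀ = -A ∧ ∀ s : ℝ, NormedSpace.exp (s • A) ∈ Γ := by
  open scoped Matrix.Norms.L2Operator in
  have hskew : Aᵀ = -A := by
    have hAt : Tendsto (fun n => ((t n)⁻¹ • (g n - 1))ᵀ) atTop (𝓝 Aᵀ) :=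
      ((continuous_id.matrix_transpose).tendsto A).comp hA
    have hprod := ht0.smul (hA.mul hAt)
    have hsum := (hA.add hAt).add hprod
    have hz : ∀ n, (t n)⁻¹ • (g n - 1) + ((t n)⁻¹ • (g n - 1))ᵀ +
        t n • ((t n)⁻¹ • (g n - 1) * ((t n)⁻¹ • (g n - 1))ᵀ) = 0 := by
      intro n
      have h := horth _ (hg n)
      have e : (g n - 1) * (g n - 1)ᵀ = - (g n - 1) - (g n - 1)ᵀ := by
        rw [Matrix.transpose_sub, Matrix.transpose_one, sub_mul, mul_sub, mul_sub, h]
        simp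
      rw [Matrix.transpose_smul, smul_mul_smul_comm, e, smul_smul,
        show t n * ((t n)⁻¹ * (t n)⁻¹) = (t n)⁻¹ by have := (ht n).ne'; field_simp]
      simp only [smul_sub, smul_neg]
      abel
    simp only [hz, zero_smul, add_zero] at hsum
    have := tendsto_nhds_unique hsum tendsto_const_nhds
    exact (neg_eq_of_add_eq_zero_right this).symm
  refine ⟨hskew, ?_⟩
  have hpow : ∀ a ∈ Γ, ∀ m : ℕ, a ^ m ∈ Γ := by
    intro a ha m
    induction m with
    | zero => simpa using hone
    | succ m ih => rw [pow_succ]; exact hmul _ ih _ ha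
  have hpos : ∀ s : ℝ, 0 ≤ s → NormedSpace.exp (s • A) ∈ Γ := by
    intro s hs
    refine hlim (fun n => g n ^ ⌊s / t n⌋₊) _ (fun n => hpow _ (hg n) _) ?_
    have h1 : Tendsto (fun n => (⌊s / t n⌋₊ : ℝ) * t n) atTop (𝓝 s) := by
      have hl : ∀ n, s - t n ≤ (⌊s / t n⌋₊ : ℝ) * t n := by
        intro n
        have := Nat.lt_floor_add_one (s / t n)
        rw [div_lt_iff₀ (ht n)] at this
        linarith
      have hu : ∀ n, (⌊s / t n⌋₊ : ℝ) * t n ≤ s := by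
        intro n
        have := Nat.floor_le (div_nonneg hs (ht n).le)
        rwa [le_div_iff₀ (ht n)] at this
      have h0 : Tendsto (fun n => s - t n) atTop (𝓝 s) := by
        simpa using tendsto_const_nhds.sub ht0
      exact tendsto_of_tendsto_of_tendsto_of_le_of_le h0 tendsto_const_nhds hl hu
    have h2 : Tendsto (fun n => NormedSpace.exp (t n • A) ^ ⌊s / t n⌋₊) atTop
        (𝓝 (NormedSpace.exp (s • A))) := by
      have e : ∀ n, NormedSpace.exp (t n • A) ^ ⌊s / t n⌋₊ =
          NormedSpace.exp (((⌊s / t n⌋₊ : ℝ) * t n) • A) := by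
        intro n
        rw [← Matrix.exp_nsmul, ← Nat.cast_smul_eq_nsmul ℝ, smul_smul]
      simp only [e]
      open scoped Matrix.Norms.L2Operator in
      exact ((hasDerivAt_exp_smul_const (𝕂 := ℝ) A s).continuousAt.tendsto).comp h1
    open scoped Matrix.Norms.L2Operator in
    have h3 : Tendsto (fun n => g n ^ ⌊s / t n⌋₊ - NormedSpace.exp (t n • A) ^ ⌊s / t n⌋₊) atTop
        (𝓝 0) := by
      have hq : Tendsto (fun n => (t n)⁻¹ • (NormedSpace.exp (t n • A) - 1)) atTop (𝓝 A) := by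
        have hd := (exp_deriv_zero A).tendsto_slope_zero
        have ht' : Tendsto t atTop (𝓝[≠] 0) :=
          tendsto_nhdsWithin_iff.2 ⟨ht0, Eventually.of_forall fun n => (ht n).ne'⟩
        have := hd.comp ht'
        simpa [Function.comp_def] using this
      have hb := ((hA.sub hq).norm).const_mul s
      rw [sub_self, norm_zero, mul_zero] at hb
      refine squeeze_zero_norm (fun n => ?_) hb
      have hn1 := norm_orth_le hd _ (horth _ (hg n))
      have hn2 := norm_orth_le hd _ (exp_skew (t n • A) (by
        rw [Matrix.transpose_smul, hskew, smul_neg]))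
      refine (pow_diff_le _ _ hn1 hn2 _).trans ?_
      rw [← smul_sub, norm_smul, sub_sub_sub_cancel_right, ← mul_assoc, Real.norm_eq_abs,
        abs_of_pos (inv_pos.2 (ht n))]
      gcongr
      exact Nat.floor_le (div_nonneg hs (ht n).le)
    have := h3.add h2
    simpa using this
  intro s
  rcases le_total 0 s with hs | hs
  · exact hpos s hs
  · have := htr _ (hpos (-s) (by linarith))
    rw [← Matrix.exp_transpose, Matrix.transpose_smul, hskew] at this
    simpa using this

open scoped Topology in
open Filter in
/-- The tangent space of a closed subgroup of the orthogonal group. -/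
lemma tangent_space {d : ℕ} (hd : 3 ≤ d) (Γ : Set (Matrix (Fin d) (Fin d) ℝ))
    (horth : ∀ a ∈ Γ, a * aᵀ = 1)
    (hone : 1 ∈ Γ) (hmul : ∀ a ∈ Γ, ∀ b ∈ Γ, a * b ∈ Γ) (htr : ∀ a ∈ Γ, aᵀ ∈ Γ)
    (hlim : ∀ (u : ℕ → Matrix (Fin d) (Fin d) ℝ) a, (∀ n, u n ∈ Γ) → Tendsto u atTop (𝓝 a) → a ∈ Γ)
    (hnd : ∃ g : ℕ → Matrix (Fin d) (Fin d) ℝ, (∀ n, g n ∈ Γ) ∧ (∀ n, g n ≠ 1) ∧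
      Tendsto g atTop (𝓝 1)) :
    ∃ W : Submodule ℝ (Matrix (Fin d) (Fin d) ℝ), (∀ A ∈ W, Aᵀ = -A) ∧
      (∀ A ∈ W, NormedSpace.exp A ∈ Γ) ∧ (∀ Q ∈ Γ, ∀ A ∈ W, Q * A * Qᵀ ∈ W) ∧
      (∃ A ∈ W, A ≠ 0) := by
  let W : Submodule ℝ (Matrix (Fin d) (Fin d) ℝ) :=
    { carrier := {A | Aᵀ = -A ∧ ∀ s : ℝ, NormedSpace.exp (s • A) ∈ Γ}
      zero_mem' := by
        refine ⟨by simp, fun s => ?_⟩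
        simpa using hone
      smul_mem' := by
        rintro c A ⟨h1, h2⟩
        refine ⟨by rw [Matrix.transpose_smul, h1, smul_neg], fun s => ?_⟩
        rw [smul_smul]; exact h2 _
      add_mem' := by
        rintro A B ⟨hA1, hA2⟩ ⟨hB1, hB2⟩
        have htp : ∀ n : ℕ, (0 : ℝ) < 1 / ((n : ℝ) + 1) := fun n => by positivity
        have ht0 := tendsto_one_div_add_atTop_nhds_zero_nat (𝕜 := ℝ)
        refine limit_lemma hd Γ horth hone hmul htr hlim
          (fun n => NormedSpace.exp ((1 / ((n : ℝ) + 1)) • A) *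
            NormedSpace.exp ((1 / ((n : ℝ) + 1)) • B)) (fun n => 1 / ((n : ℝ) + 1)) (A + B)
          (fun n => hmul _ (hA2 _) _ (hB2 _)) htp ht0 ?_
        open scoped Matrix.Norms.L2Operator in
        have hdv := ((exp_deriv_zero A).mul (exp_deriv_zero B)).tendsto_slope_zero
        have ht' : Tendsto (fun n : ℕ => 1 / ((n : ℝ) + 1)) atTop (𝓝[≠] 0) :=
          tendsto_nhdsWithin_iff.2 ⟨ht0, Eventually.of_forall fun n => (htp n).ne'⟩
        have := hdv.comp ht'
        simpa [Function.comp_def] using this }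
  refine ⟨W, fun A hA => hA.1, fun A hA => by simpa using hA.2 1, ?_, ?_⟩
  · rintro Q hQ A ⟨h1, h2⟩
    refine ⟨?_, fun s => ?_⟩
    · rw [Matrix.transpose_mul, Matrix.transpose_mul, Matrix.transpose_transpose, h1]
      noncomm_ring
    · have hi : Q⁻¹ = Qᵀ := Matrix.inv_eq_right_inv (horth Q hQ)
      have hu : IsUnit Q := IsUnit.of_mul_eq_one _ (horth Q hQ)
      have e : s • (Q * A * Qᵀ) = Q * (s • A) * Q⁻¹ := by
        rw [hi]; simp
      rw [e, Matrix.exp_conj _ _ hu, hi]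
      exact hmul _ (hmul _ hQ _ (h2 s)) _ (htr _ hQ)
  · obtain ⟨g, hg, hg1, hgt⟩ := hnd
    open scoped Matrix.Norms.L2Operator in
    have key : ∃ A : Matrix (Fin d) (Fin d) ℝ, A ≠ 0 ∧ ∃ ψ : ℕ → ℕ, StrictMono ψ ∧
        ∃ t : ℕ → ℝ, (∀ n, 0 < t n) ∧ Tendsto t atTop (𝓝 0) ∧ 
        Tendsto (fun n => (t n)⁻¹ • (g (ψ n) - 1)) atTop (𝓝 A) := by
      have hpos : ∀ n, 0 < ‖g n - 1‖ := fun n => norm_pos_iff.2 (sub_ne_zero.2 (hg1 n))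
      have : ProperSpace (Matrix (Fin d) (Fin d) ℝ) := FiniteDimensional.proper ℝ _
      have hmem : ∀ n, ‖g n - 1‖⁻¹ • (g n - 1) ∈
          Metric.sphere (0 : Matrix (Fin d) (Fin d) ℝ) 1 := by
        intro n
        rw [mem_sphere_zero_iff_norm, norm_smul, norm_inv, norm_norm,
          inv_mul_cancel₀ (hpos n).ne']
      obtain ⟨A, hA, ψ, hψ, hlimA⟩ := (isCompact_sphere _ _).tendsto_subseq hmem
      refine ⟨A, ?_, ψ, hψ, fun n => ‖g (ψ n) - 1‖, fun n => hpos _, ?_, hlimA⟩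
      · rintro rfl
        simp at hA
      · have : Tendsto (fun n => ‖g n - 1‖) atTop (𝓝 0) := by
          have := (hgt.sub_const 1).norm
          simpa using this
        exact this.comp hψ.tendsto_atTop
    obtain ⟨A, hA, ψ, hψ, t, ht, ht0, hlimA⟩ := key
    exact ⟨A, limit_lemma hd Γ horth hone hmul htr hlim (fun n => g (ψ n)) t A
      (fun n => hg _) ht ht0 hlimA, hA⟩

/-- Householder reflection matrix -/
noncomputable def House {n : ℕ} (v : Fin n → ℝ) : Matrix (Fin n) (Fin n) ℝ :=
  1 - (2 / (v ⬝ᵥ v)) • vecMulVec v v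

lemma House_zero {n : ℕ} : House (0 : Fin n → ℝ) = 1 := by
  simp [House]

lemma dot_self_ne {n : ℕ} {v : Fin n → ℝ} (hv : v ≠ 0) : v ⬝ᵥ v ≠ 0 := by
  simpa [dotProduct_self_eq_zero] using hv

lemma House_smul {n : ℕ} (v : Fin n → ℝ) {c : ℝ} (hc : c ≠ 0) : House (c • v) = House v := by
  by_cases hv : v = 0
  · simp [hv]
  have := dot_self_ne hv
  unfold House
  congr 1
  rw [smul_vecMulVec, vecMulVec_smul, smul_smul, smul_smul]
  congr 1
  simp only [dotProduct_smul, smul_dotProduct, smul_eq_mul]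
  field_simp

lemma House_transpose {n : ℕ} (v : Fin n → ℝ) : (House v)ᵀ = House v := by
  simp [House, transpose_vecMulVec]

lemma House_sq {n : ℕ} (v : Fin n → ℝ) : House v * House v = 1 := by
  by_cases hv : v = 0
  · simp [hv, House_zero]
  have := dot_self_ne hv
  simp only [House, sub_mul, mul_sub, one_mul, mul_one, smul_mul_smul_comm,
    vecMulVec_mul_vecMulVec, vecMulVec_smul, smul_smul]
  rw [show 2 / (v ⬝ᵥ v) * (2 / (v ⬝ᵥ v)) * (v ⬝ᵥ v) = 2 / (v ⬝ᵥ v) + 2 / (v ⬝ᵥ v) by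
    field_simp; ring, add_smul]
  abel

lemma House_det {n : ℕ} {v : Fin n → ℝ} (hv : v ≠ 0) : (House v).det = -1 := by
  have h0 := dot_self_ne hv
  have h := det_one_add_replicateCol_mul_replicateRow (ι := Unit) ((-(2 / (v ⬝ᵥ v))) • v) v
  have e : replicateCol Unit ((-(2 / (v ⬝ᵥ v))) • v) * replicateRow Unit v =
      (-(2 / (v ⬝ᵥ v))) • vecMulVec v v := by
    rw [← smul_vecMulVec, vecMulVec_eq Unit]
  rw [e] at h
  unfold House
  rw [sub_eq_add_neg, ← neg_smul, h, dotProduct_smul, smul_eq_mul]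
  field_simp
  ring

lemma reflection_eq_House {n : ℕ} (v x : EuclideanSpace ℝ (Fin n)) :
    (Submodule.reflection (Submodule.span ℝ {v})ᗮ x).ofLp = House v.ofLp *ᵥ x.ofLp := by
  rw [Submodule.reflection_orthogonal_apply, Submodule.reflection_singleton_apply]
  have h1 : inner ℝ v x = v.ofLp ⬝ᵥ x.ofLp := by
    rw [EuclideanSpace.inner_eq_star_dotProduct]; simp [dotProduct_comm]
  have h2 : ((‖v‖ : ℝ)) ^ 2 = v.ofLp ⬝ᵥ v.ofLp := by
    rw [← real_inner_self_eq_norm_sq, EuclideanSpace.inner_eq_star_dotProduct]; simp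
  simp only [RCLike.ofReal_real_eq_id, id_eq]
  rw [h1, h2]
  simp only [House, sub_mulVec, one_mulVec, smul_mulVec, vecMulVec_mulVec]
  ext i
  simp
  ring

lemma prod_reflection_eq {n : ℕ} (l : List (EuclideanSpace ℝ (Fin n)))
    (x : EuclideanSpace ℝ (Fin n)) :
    ((l.map fun v => Submodule.reflection (Submodule.span ℝ {v})ᗮ).prod x).ofLp =
      (l.map fun v => House v.ofLp).prod *ᵥ x.ofLp := by
  induction l with
  | nil => simp
  | cons v l ih =>
    rw [List.map_cons, List.prod_cons, List.map_cons, List.prod_cons, ← mulVec_mulVec, ← ih]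
    exact reflection_eq_House v _

lemma orth_eq_prod {n : ℕ} (Q : Matrix (Fin n) (Fin n) ℝ) (hQ : Q * Qᵀ = 1) :
    ∃ l : List (Fin n → ℝ), Q = (l.map House).prod := by
  have hQ' : Qᵀ * Q = 1 := mul_eq_one_comm.1 hQ
  let f : EuclideanSpace ℝ (Fin n) →ₗᵢ[ℝ] EuclideanSpace ℝ (Fin n) :=
    { toLinearMap := Matrix.toEuclideanLin Q
      norm_map' := by
        intro x
        have h2 : ∀ v : EuclideanSpace ℝ (Fin n), ((‖v‖ : ℝ)) ^ 2 = v.ofLp ⬝ᵥ v.ofLp := by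
          intro v
          rw [← real_inner_self_eq_norm_sq, EuclideanSpace.inner_eq_star_dotProduct]; simp
        have : ‖Matrix.toEuclideanLin Q x‖ ^ 2 = ‖x‖ ^ 2 := by
          rw [h2, h2]
          change (Q *ᵥ x.ofLp) ⬝ᵥ (Q *ᵥ x.ofLp) = _
          rw [dotProduct_mulVec, ← mulVec_transpose, mulVec_mulVec, hQ', one_mulVec]
        exact (sq_eq_sq₀ (norm_nonneg _) (norm_nonneg _)).1 this }
  let F := f.toLinearIsometryEquiv rfl
  obtain ⟨l, -, hl⟩ := F.reflections_generate_dim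
  refine ⟨l.map (fun v => v.ofLp), ?_⟩
  apply Matrix.ext_of_mulVec_single
  intro i
  have h := prod_reflection_eq l (WithLp.toLp 2 (Pi.single i 1))
  rw [← hl] at h
  rw [List.map_map]
  exact h

lemma cartan_s3 {n : ℕ} (S : Set (Matrix (Fin n) (Fin n) ℝ)) (hone : 1 ∈ S)
    (hmul : ∀ a ∈ S, ∀ b ∈ S, a * b ∈ S)
    (hH : ∀ u v : Fin n → ℝ, u ≠ 0 → v ≠ 0 → House u * House v ∈ S)
    (Q : Matrix (Fin n) (Fin n) ℝ) (hQ : Q * Qᵀ = 1) (hdet : Q.det = 1) : Q ∈ S := by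
  obtain ⟨l, rfl⟩ := orth_eq_prod Q hQ
  have key : ∀ l : List (Fin n → ℝ), ((l.map House).prod ∈ S ∧ (l.map House).prod.det = 1) ∨
      ((l.map House).prod.det = -1 ∧ ∃ u, u ≠ 0 ∧ House u * (l.map House).prod ∈ S) := by
    intro l
    induction l with
    | nil => left; simpa using hone
    | cons v l ih =>
      rw [List.map_cons, List.prod_cons]
      by_cases hv : v = 0
      · rw [hv, House_zero, one_mul]; exact ih
      rcases ih with ⟨h1, h2⟩ | ⟨h1, u, hu, h2⟩
      · right
        refine ⟨by rw [det_mul, House_det hv, h2]; norm_num, v, hv, ?_⟩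
        rw [← mul_assoc, House_sq, one_mul]; exact h1
      · left
        refine ⟨?_, by rw [det_mul, House_det hv, h1]; norm_num⟩
        have := hmul _ (hH v u hv hu) _ h2
        rwa [mul_assoc, ← mul_assoc (House u), House_sq, one_mul] at this
  rcases key l with h | h
  · exact h.1
  · rw [hdet] at h; norm_num at h

lemma rodrigues_aux {R : Type*} [NormedRing R] [NormedAlgebra ℝ R] [CompleteSpace R]
    (J : R) (hJ : J * J * J = -J) (t : ℝ) :
    NormedSpace.exp (t • J) = 1 + Real.sin t • J + (1 - Real.cos t) • (J * J) := by
  have hd : ∀ s : ℝ, HasDerivAt (fun s : ℝ => NormedSpace.exp (s • (-J)) *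
      (1 + Real.sin s • J + (1 - Real.cos s) • (J * J))) 0 s := by
    intro s
    have h1 := hasDerivAt_exp_smul_const (𝕂 := ℝ) (-J) s
    have h2 : HasDerivAt (fun s : ℝ => 1 + Real.sin s • J + (1 - Real.cos s) • (J * J))
        (Real.cos s • J + Real.sin s • (J * J)) s := by
      have := (((Real.hasDerivAt_sin s).smul_const J).const_add 1).add
        (((Real.hasDerivAt_cos s).const_sub 1).smul_const (J * J))
      exact this.congr_deriv (by simp)
    have h3 := h1.mul h2
    refine HasDerivAt.congr_deriv h3 ?_
    rw [mul_assoc, ← mul_add]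
    have : -J * (1 + Real.sin s • J + (1 - Real.cos s) • (J * J)) +
        (Real.cos s • J + Real.sin s • (J * J)) = 0 := by
      rw [mul_add, mul_add, mul_smul_comm, mul_smul_comm, neg_mul, neg_mul, neg_mul, ← mul_assoc,
        hJ, mul_one, sub_smul]
      simp
      abel
    rw [this, mul_zero]
  have hc := is_const_of_deriv_eq_zero (fun s => (hd s).differentiableAt)
    (fun s => (hd s).deriv) t 0
  simp only [zero_smul, NormedSpace.exp_zero, Real.sin_zero, Real.cos_zero, sub_self, add_zero,
    mul_one] at hc
  have hi : NormedSpace.exp (t • J) * NormedSpace.exp (t • (-J)) = 1 := by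
    let _ : NormedAlgebra ℚ R := NormedAlgebra.restrictScalars ℚ ℝ R
    rw [smul_neg, ← NormedSpace.exp_add_of_commute (Commute.neg_right (Commute.refl (t • J)))]
    simp
  calc NormedSpace.exp (t • J) = NormedSpace.exp (t • J) * (NormedSpace.exp (t • (-J)) *
      (1 + Real.sin t • J + (1 - Real.cos t) • (J * J))) := by rw [hc, mul_one]
    _ = _ := by rw [← mul_assoc, hi, one_mul]

open scoped Matrix.Norms.L2Operator in
lemma rodrigues {n : ℕ} (J : Matrix (Fin n) (Fin n) ℝ) (hJ : J * J * J = -J) (t : ℝ) :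
    NormedSpace.exp (t • J) = 1 + Real.sin t • J + (1 - Real.cos t) • (J * J) :=
  rodrigues_aux J hJ t

lemma House_exp_unit {n : ℕ} (u v : Fin n → ℝ) (hu : u ⬝ᵥ u = 1) (hv : v ⬝ᵥ v = 1) :
    ∃ A : Matrix (Fin n) (Fin n) ℝ, Aᵀ = -A ∧ NormedSpace.exp A = House u * House v := by
  set c := u ⬝ᵥ v with hc
  have hvu : v ⬝ᵥ u = c := dotProduct_comm _ _
  have hsq : (v - c • u) ⬝ᵥ (v - c • u) = 1 - c ^ 2 := by
    simp only [sub_dotProduct, dotProduct_sub, smul_dotProduct, dotProduct_smul, hu, hv, hvu,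
      ← hc, smul_eq_mul]
    ring
  by_cases h0 : v - c • u = 0
  · have hvc : v = c • u := sub_eq_zero.1 h0
    have hc0 : c ≠ 0 := by
      intro h; rw [h, zero_smul] at hvc; rw [hvc] at hv; simp at hv
    refine ⟨0, by simp, ?_⟩
    rw [hvc, House_smul _ hc0, House_sq]; simp
  have hpos : 0 < 1 - c ^ 2 := by
    rw [← hsq]
    exact lt_of_le_of_ne (by simpa using dotProduct_star_self_nonneg (v - c • u)) (dot_self_ne h0).symm
  set s := Real.sqrt (1 - c ^ 2) with hs
  have hs0 : 0 < s := Real.sqrt_pos.2 hpos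
  have hss : s ^ 2 = 1 - c ^ 2 := Real.sq_sqrt hpos.le
  set w := s⁻¹ • (v - c • u) with hw
  have hww : w ⬝ᵥ w = 1 := by
    rw [hw, smul_dotProduct, dotProduct_smul, hsq, ← hss, smul_eq_mul, smul_eq_mul]
    field_simp
  have huw : u ⬝ᵥ w = 0 := by
    rw [hw, dotProduct_smul, dotProduct_sub, dotProduct_smul, hu, ← hc]; simp
  have hwu : w ⬝ᵥ u = 0 := by rw [dotProduct_comm, huw]
  have hvw : v = c • u + s • w := by
    rw [hw, smul_smul, mul_inv_cancel₀ hs0.ne', one_smul]; abel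
  set J := vecMulVec u w - vecMulVec w u with hJ
  have hJ2 : J * J = - vecMulVec u u - vecMulVec w w := by
    simp only [hJ, sub_mul, mul_sub, vecMulVec_mul_vecMulVec, hww, huw, hwu, hu, zero_smul,
      one_smul, vecMulVec_zero]
    abel
  have hJ3 : J * J * J = -J := by
    rw [hJ2]
    simp only [hJ, sub_mul, mul_sub, neg_mul, vecMulVec_mul_vecMulVec, hww, huw, hwu, hu,
      zero_smul, one_smul, vecMulVec_zero]
    abel
  have hJt : Jᵀ = -J := by
    simp [hJ, transpose_vecMulVec]
  refine ⟨(2 * Real.arccos c) • J, by rw [transpose_smul, hJt, smul_neg], ?_⟩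
  have hc1 : -1 ≤ c := by nlinarith
  have hc2 : c ≤ 1 := by nlinarith
  rw [rodrigues J hJ3, Real.sin_two_mul, Real.cos_two_mul, Real.sin_arccos, Real.cos_arccos hc1 hc2,
    ← hs, hJ2]
  unfold House
  rw [hu, hv, div_one]
  simp only [sub_mul, mul_sub, one_mul, mul_one, smul_mul_smul_comm, vecMulVec_mul_vecMulVec, ← hc]
  rw [hvw, hJ]
  simp only [vecMulVec_smul, smul_vecMulVec, add_vecMulVec, vecMulVec_add]
  ext i j
  simp only [Matrix.add_apply, Matrix.sub_apply, Matrix.smul_apply, Matrix.neg_apply, smul_eq_mul]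
  generalize vecMulVec u u i j = a
  generalize vecMulVec u w i j = b
  generalize vecMulVec w u i j = e
  generalize vecMulVec w w i j = f
  linear_combination (2 * f) * hss

lemma House_exp {n : ℕ} (u v : Fin n → ℝ) (hu : u ≠ 0) (hv : v ≠ 0) :
    ∃ A : Matrix (Fin n) (Fin n) ℝ, Aᵀ = -A ∧ NormedSpace.exp A = House u * House v := by
  have key : ∀ u : Fin n → ℝ, u ≠ 0 → ∃ u' : Fin n → ℝ, u' ⬝ᵥ u' = 1 ∧ House u' = House u := by
    intro u hu
    have h0 : 0 < u ⬝ᵥ u := 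
      lt_of_le_of_ne (by simpa using dotProduct_star_self_nonneg u) (dot_self_ne hu).symm
    have h1 := Real.sqrt_pos.2 h0
    refine ⟨(Real.sqrt (u ⬝ᵥ u))⁻¹ • u, ?_, House_smul _ (inv_ne_zero h1.ne')⟩
    rw [smul_dotProduct, dotProduct_smul, smul_eq_mul, smul_eq_mul]
    have := Real.mul_self_sqrt h0.le
    field_simp
    linarith
  obtain ⟨u', hu', hu''⟩ := key u hu
  obtain ⟨v', hv', hv''⟩ := key v hv
  rw [← hu'', ← hv'']
  exact House_exp_unit u' v' hu' hv'

lemma SO_orth {n : ℕ} (g : SO n) : SOmat g * (SOmat g)ᵀ = 1 := by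
  have := (Matrix.mem_orthogonalGroup_iff (Fin n) ℝ).1 g.1.2
  simpa [SOmat, Matrix.star_eq_conjTranspose] using this

lemma SO_det {n : ℕ} (g : SO n) : (SOmat g).det = 1 := g.2

lemma SOmat_mul {n : ℕ} (g h : SO n) : SOmat (g * h) = SOmat g * SOmat h := rfl

lemma SOmat_one {n : ℕ} : SOmat (1 : SO n) = 1 := rfl

lemma SOmat_inj {n : ℕ} {g h : SO n} (e : SOmat g = SOmat h) : g = h :=
  Subtype.ext (Subtype.ext e)

lemma SOmat_inv {n : ℕ} (g : SO n) : SOmat g⁻¹ = (SOmat g)ᵀ := by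
  have h : SOmat g * SOmat g⁻¹ = 1 := by rw [← SOmat_mul, mul_inv_cancel, SOmat_one]
  calc SOmat g⁻¹ = (SOmat g)ᵀ * SOmat g * SOmat g⁻¹ := by
        rw [mul_eq_one_comm.1 (SO_orth g), one_mul]
    _ = _ := by rw [mul_assoc, h, mul_one]

lemma SOmat_continuous {n : ℕ} : Continuous (SOmat : SO n → Matrix (Fin n) (Fin n) ℝ) :=
  continuous_subtype_val.comp continuous_subtype_val

def mkSO {n : ℕ} (Q : Matrix (Fin n) (Fin n) ℝ) (hQ : Q * Qᵀ = 1) (hdet : Q.det = 1) : SO n :=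
  ⟨⟨Q, (Matrix.mem_orthogonalGroup_iff (Fin n) ℝ).2 (by
    simpa [Matrix.star_eq_conjTranspose] using hQ)⟩, hdet⟩

lemma HH_orth {n : ℕ} (u v : Fin n → ℝ) : House u * House v * (House u * House v)ᵀ = 1 := by
  rw [transpose_mul, House_transpose, House_transpose, mul_assoc, ← mul_assoc (House v), House_sq,
    one_mul, House_sq]

/-- product of two reflections -/
noncomputable def HH {n : ℕ} (u v : {v : Fin n → ℝ // v ≠ 0}) : SO n :=
  mkSO (House u.1 * House v.1) (HH_orth _ _) (by
    rw [det_mul, House_det u.2, House_det v.2]; norm_num)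

lemma HH_continuous {n : ℕ} (u : {v : Fin n → ℝ // v ≠ 0}) : Continuous (HH u) := by
  have h : Continuous fun v : {v : Fin n → ℝ // v ≠ 0} => House u.1 * House v.1 := by
    refine continuous_const.mul ?_
    unfold House
    have h1 : Continuous fun v : {v : Fin n → ℝ // v ≠ 0} => 2 / (v.1 ⬝ᵥ v.1) := by
      refine continuous_const.div ?_ fun v => dot_self_ne v.2
      exact continuous_subtype_val.dotProduct continuous_subtype_val
    exact continuous_const.sub
      (h1.smul (continuous_subtype_val.matrix_vecMulVec continuous_subtype_val))
  exact (h.subtype_mk _).subtype_mk _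

lemma HH_mul {n : ℕ} (u v w : {v : Fin n → ℝ // v ≠ 0}) : HH u v * HH v w = HH u w := by
  apply SOmat_inj
  change House u.1 * House v.1 * (House v.1 * House w.1) = House u.1 * House w.1
  rw [mul_assoc, ← mul_assoc (House v.1), House_sq, one_mul]

lemma HH_self {n : ℕ} (u : {v : Fin n → ℝ // v ≠ 0}) : HH u u = 1 := by
  apply SOmat_inj
  exact House_sq u.1

open scoped Topology in
open Filter in
lemma nondiscrete {d k : ℕ} (hk : 3 ≤ k) (φ : SO k →* SO d) (hφ : Continuous φ)
    (hnt : ∃ g, φ g ≠ 1) :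
    ∃ g : ℕ → Matrix (Fin d) (Fin d) ℝ, (∀ n, ∃ h, g n = SOmat (φ h)) ∧ (∀ n, g n ≠ 1) ∧
      Tendsto g atTop (𝓝 1) := by
  by_cases hcl : (1 : Matrix (Fin d) (Fin d) ℝ) ∈ closure {M | (∃ h, M = SOmat (φ h)) ∧ M ≠ 1}
  · have : FrechetUrysohnSpace (Matrix (Fin d) (Fin d) ℝ) :=
      inferInstanceAs (FrechetUrysohnSpace (Fin d → Fin d → ℝ))
    obtain ⟨g, hg, hg'⟩ := mem_closure_iff_seq_limit.1 hcl
    exact ⟨g, fun n => (hg n).1, fun n => (hg n).2, hg'⟩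
  exfalso
  have hev : ∀ᶠ M in 𝓝 (1 : Matrix (Fin d) (Fin d) ℝ), (∃ h, M = SOmat (φ h)) → M = 1 := by
    rw [mem_closure_iff_frequently, not_frequently] at hcl
    filter_upwards [hcl] with M hM h
    by_contra hne
    exact hM ⟨h, hne⟩
  have hker : ∀ u v : {v : Fin k → ℝ // v ≠ 0}, φ (HH u v) = 1 := by
    intro u
    have hlc : IsLocallyConstant fun v : {v : Fin k → ℝ // v ≠ 0} => φ (HH u v) := by
      rw [IsLocallyConstant.iff_eventually_eq]
      intro w
      have hc : Tendsto (fun v => SOmat (φ (HH w v))) (𝓝 w) (𝓝 1) := by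
        have h := ((SOmat_continuous.comp (hφ.comp (HH_continuous w))).tendsto w)
        simp only [Function.comp_apply, HH_self, map_one, SOmat_one] at h
        exact h
      filter_upwards [hc.eventually hev] with v hv
      have h1 : φ (HH w v) = 1 := SOmat_inj (hv ⟨_, rfl⟩)
      rw [← HH_mul u w v, map_mul, h1, mul_one]
    have hpc : PreconnectedSpace {v : Fin k → ℝ // v ≠ 0} := by
      have : IsPreconnected ({0}ᶜ : Set (Fin k → ℝ)) :=
        (isConnected_compl_singleton_of_one_lt_rank (by
          rw [rank_fin_fun]; exact_mod_cast (by omega : 1 < k)) 0).isPreconnected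
      exact Subtype.preconnectedSpace this
    intro v
    have := hlc.apply_eq_of_preconnectedSpace v u
    rw [this, HH_self, map_one]
  obtain ⟨g, hg⟩ := hnt
  apply hg
  have := cartan_s3 {M | ∃ g : SO k, SOmat g = M ∧ φ g = 1} ⟨1, SOmat_one, map_one φ⟩
    (by
      rintro _ ⟨a, rfl, ha⟩ _ ⟨b, rfl, hb⟩
      exact ⟨a * b, SOmat_mul a b, by rw [map_mul, ha, hb, mul_one]⟩)
    (fun u v hu hv => ⟨HH ⟨u, hu⟩ ⟨v, hv⟩, rfl, hker _ _⟩) (SOmat g) (SO_orth g) (SO_det g)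
  obtain ⟨g', h1, h2⟩ := this
  rw [← SOmat_inj h1]; exact h2

lemma nontrivial_of_irr {d k : ℕ} (hd : 3 ≤ d) (φ : SO k →* SO d)
    (hirr : ∀ W : Submodule ℝ (Fin d → ℝ),
        (∀ g : SO k, W.map (Matrix.mulVecLin (SOmat (φ g))) = W) → W = ⊥ ∨ W = ⊤) :
    ∃ g, φ g ≠ 1 := by
  by_contra! hcon
  have i0 : Fin d := ⟨0, by omega⟩
  let x : Fin d → ℝ := Pi.single ⟨0, by omega⟩ 1
  rcases hirr (Submodule.span ℝ {x}) (fun g => by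
    rw [hcon g, SOmat_one, Matrix.mulVecLin_one, Submodule.map_id]) with h | h
  · rw [Submodule.span_singleton_eq_bot] at h
    have := congrFun h ⟨0, by omega⟩
    simp [x] at this
  · have h1 : Module.finrank ℝ (Submodule.span ℝ {x}) ≤ 1 := by
      have := finrank_span_le_card (R := ℝ) ({x} : Set (Fin d → ℝ))
      simpa using this
    rw [h, finrank_top] at h1
    simp at h1
    omega

open scoped Topology in
open Filter in
lemma law_closed {d : ℕ} (μ : Measure (Fin d → ℝ)) [IsProbabilityMeasure μ]
    (u : ℕ → Matrix (Fin d) (Fin d) ℝ) (a : Matrix (Fin d) (Fin d) ℝ)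
    (hu : ∀ n, μ.map (fun x => u n *ᵥ x) = μ) (hlim : Tendsto u atTop (𝓝 a)) :
    μ.map (fun x => a *ᵥ x) = μ := by
  have hc : ∀ a : Matrix (Fin d) (Fin d) ℝ, Continuous fun x : Fin d → ℝ => a *ᵥ x :=
    fun a => continuous_const.matrix_mulVec continuous_id
  have : IsProbabilityMeasure (μ.map (fun x => a *ᵥ x)) :=
    Measure.isProbabilityMeasure_map (hc a).measurable.aemeasurable
  refine ext_of_forall_integral_eq_of_IsFiniteMeasure fun f => ?_
  have hm : ∀ a : Matrix (Fin d) (Fin d) ℝ, ∫ x, f x ∂(μ.map (fun x => a *ᵥ x)) =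
      ∫ x, f (a *ᵥ x) ∂μ := fun a =>
    integral_map (hc a).measurable.aemeasurable f.continuous.aestronglyMeasurable
  have ht : Tendsto (fun n => ∫ x, f (u n *ᵥ x) ∂μ) atTop (𝓝 (∫ x, f (a *ᵥ x) ∂μ)) := by
    refine tendsto_integral_of_dominated_convergence (fun _ => ‖f‖) ?_ ?_ ?_ ?_
    · exact fun n => (f.continuous.comp (hc (u n))).aestronglyMeasurable
    · exact integrable_const _
    · exact fun n => Eventually.of_forall fun x => f.norm_coe_le_norm _
    · refine Eventually.of_forall fun x => ?_
      have h1 : Continuous fun b : Matrix (Fin d) (Fin d) ℝ => f (b *ᵥ x) :=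
        f.continuous.comp (continuous_id.matrix_mulVec continuous_const)
      exact (h1.tendsto a).comp hlim
  have he : ∀ n, ∫ x, f (u n *ᵥ x) ∂μ = ∫ x, f x ∂μ := by
    intro n; rw [← hm, hu]
  simp only [he] at ht
  rw [hm]
  exact tendsto_nhds_unique ht tendsto_const_nhds

theorem statement3 {Ω : Type*} [MeasurableSpace Ω] (P : Measure Ω) [IsProbabilityMeasure P]
    (d k : ℕ) (hd : 3 ≤ d) (hk : 3 ≤ k)
    (X : Ω → (Fin d → ℝ)) (hX : Measurable X)
    (φ : SO k →* SO d) (hφcont : Continuous φ)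
    (hirr : ∀ W : Submodule ℝ (Fin d → ℝ),
        (∀ g : SO k, W.map (Matrix.mulVecLin (SOmat (φ g))) = W) → W = ⊥ ∨ W = ⊤)
    (hinv : ∀ g : SO k,
        Measure.map (fun ω => SOmat (φ g) *ᵥ X ω) P = Measure.map X P)
    (hexch : ∀ π : Equiv.Perm (Fin d),
        Measure.map (fun ω => fun i => X ω (π i)) P = Measure.map X P) :
    ∀ O : SO d, Measure.map (fun ω => SOmat O *ᵥ X ω) P = Measure.map X P := by
  intro O
  set μ := Measure.map X P with hμ
  have hprob : IsProbabilityMeasure μ := Measure.isProbabilityMeasure_map hX.aemeasurable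
  have hm : ∀ a : Matrix (Fin d) (Fin d) ℝ, Measurable fun x : Fin d → ℝ => a *ᵥ x :=
    fun a => (continuous_const.matrix_mulVec continuous_id).measurable
  have hcomp : ∀ a : Matrix (Fin d) (Fin d) ℝ,
      Measure.map (fun ω => a *ᵥ X ω) P = μ.map (fun x => a *ᵥ x) := by
    intro a
    rw [hμ, Measure.map_map (hm a) hX]; rfl
  set Γ : Set (Matrix (Fin d) (Fin d) ℝ) := {a | a * aᵀ = 1 ∧ μ.map (fun x => a *ᵥ x) = μ} with hΓ
  have horth : ∀ a ∈ Γ, a * aᵀ = 1 := fun a ha => ha.1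
  have hone : 1 ∈ Γ := by
    refine ⟨by simp, ?_⟩
    simp
  have hmap2 : ∀ a b : Matrix (Fin d) (Fin d) ℝ,
      μ.map (fun x => (a * b) *ᵥ x) = (μ.map (fun x => b *ᵥ x)).map (fun x => a *ᵥ x) := by
    intro a b
    rw [Measure.map_map (hm a) (hm b)]
    congr 1
    ext x : 1
    simp
  have hmul : ∀ a ∈ Γ, ∀ b ∈ Γ, a * b ∈ Γ := by
    rintro a ⟨ha1, ha2⟩ b ⟨hb1, hb2⟩
    refine ⟨?_, ?_⟩
    · rw [transpose_mul, mul_assoc, ← mul_assoc b, hb1, one_mul, ha1]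
    · rw [hmap2, hb2, ha2]
  have htr : ∀ a ∈ Γ, aᵀ ∈ Γ := by
    rintro a ⟨ha1, ha2⟩
    have ha3 : aᵀ * a = 1 := mul_eq_one_comm.1 ha1
    refine ⟨by rw [transpose_transpose, ha3], ?_⟩
    have h := hmap2 aᵀ a
    rw [ha2, ha3] at h
    rw [← h]; simp
  have hlim : ∀ (u : ℕ → Matrix (Fin d) (Fin d) ℝ) a, (∀ n, u n ∈ Γ) →
      Filter.Tendsto u Filter.atTop (nhds a) → a ∈ Γ := by
    intro u a hu ht
    refine ⟨?_, law_closed μ u a (fun n => (hu n).2) ht⟩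
    have h1 : Filter.Tendsto (fun n => u n * (u n)ᵀ) Filter.atTop (nhds (a * aᵀ)) :=
      ((continuous_id.matrix_mul continuous_id.matrix_transpose).tendsto a).comp ht
    simp only [fun n => (hu n).1] at h1
    exact (tendsto_nhds_unique h1 tendsto_const_nhds)
  have hφΓ : ∀ g, SOmat (φ g) ∈ Γ := by
    intro g
    exact ⟨SO_orth _, by rw [← hcomp]; exact hinv g⟩
  have hpermΓ : ∀ σ : Equiv.Perm (Fin d), (1 : Matrix (Fin d) (Fin d) ℝ).submatrix σ id ∈ Γ := by
    intro σ
    refine ⟨?_, ?_⟩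
    · ext i j
      simp [Matrix.mul_apply, Matrix.one_apply]
    · rw [← hcomp, ← hexch σ]
      congr 1
      ext ω i
      simp [Matrix.mulVec, dotProduct, Matrix.one_apply]
  obtain ⟨g, hg1, hg2, hg3⟩ := nondiscrete hk φ hφcont (nontrivial_of_irr hd φ hirr)
  obtain ⟨W, hskew, hexp, hconj, hne⟩ := tangent_space hd Γ horth hone hmul htr hlim
    ⟨g, fun n => by obtain ⟨h, e⟩ := hg1 n; rw [e]; exact hφΓ h, hg2, hg3⟩
  have hperm : ∀ σ : Equiv.Perm (Fin d), ∀ A ∈ W, A.submatrix σ σ ∈ W := by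
    intro σ A hA
    have h := hconj _ (hpermΓ σ) A hA
    convert h using 1
    ext i j
    simp [Matrix.mul_apply, Matrix.one_apply]
  have hc := irr_cases hd (Set.range fun g => SOmat (φ g))
    (by rintro _ ⟨g, rfl⟩; exact SO_orth _)
    (by rintro _ ⟨g, rfl⟩; exact ⟨g⁻¹, by simp only [map_inv, SOmat_inv]⟩)
    (fun U hU => hirr U fun g => hU _ ⟨g, rfl⟩) W hskew hperm
    (by rintro _ ⟨g, rfl⟩ A hA; exact hconj _ (hφΓ g) A hA) hne
  have hall := span_all hd W hskew hperm hc.1 hc.2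
  have hO : SOmat O ∈ Γ := by
    refine cartan_s3 Γ hone hmul ?_ _ (SO_orth O) (SO_det O)
    intro u v hu hv
    obtain ⟨A, hA, hA'⟩ := House_exp u v hu hv
    rw [← hA']
    exact hexp A (hall A hA)
  rw [hcomp]
  exact hO.2
end
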